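/- The function φ : (0,∞) → [0,1] defined by φ(x) := dim_H 𝐔(x) is non-increasing and continuous on (0,∞), and Lebesgue-almost every x ∈ (0,∞) has an open neighborhood on which φ is constant. -/

import Mathlib

open scoped ENNReal NNReal Classical

namespace Expansions

/-- Digit sequences over the alphabet `{0,1,…,M}`; index `i : ℕ` represents the
`(i+1)`-st digit `d_{i+1}` of the paper. -/
abbrev Digits (M : ℕ) := ℕ → Fin (M + 1)

/-- `π_q((d_i)) = Σ_{i≥1} d_i / q^i`. -/
noncomputable def piQ (M : ℕ) (q : ℝ) (d : Digits M) : ℝ :=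
  ∑' i : ℕ, (d i : ℝ) / q ^ (i + 1)

/-- `𝒰_q` : the set of real numbers having a unique `q`-expansion. -/
def Uq (M : ℕ) (q : ℝ) : Set ℝ := {x | ∃! d : Digits M, piQ M q d = x}

/-- `𝐔_q` : the set of sequences that are the unique `q`-expansion of their value. -/
def UqSym (M : ℕ) (q : ℝ) : Set (Digits M) :=
  {d | ∀ e : Digits M, piQ M q e = piQ M q d → e = d}

/-- `𝒰(x)` : the set of univoque bases of `x`. -/
def Ubases (M : ℕ) (x : ℝ) : Set ℝ :=
  {q | q ∈ Set.Ioc (1 : ℝ) ((M : ℝ) + 1) ∧ x ∈ Uq M q}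

/-- `q_x = min{M+1, 1+M/x}`. -/
noncomputable def qx (M : ℕ) (x : ℝ) : ℝ := min ((M : ℝ) + 1) (1 + (M : ℝ) / x)

/-- Strict lexicographic order on digit sequences. -/
def lexLt {M : ℕ} (c d : Digits M) : Prop := ∃ n, (∀ i < n, c i = d i) ∧ c n < d n

def lexLe {M : ℕ} (c d : Digits M) : Prop := c = d ∨ lexLt c d

/-- The sequence ends with `0^∞`. -/
def EndsInZero {M : ℕ} (d : Digits M) : Prop := ∃ N, ∀ n ≥ N, d n = 0

/-- `d` is the quasi-greedy `q`-expansion of `x`: the lexicographically largest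
`q`-expansion of `x` not ending with `0^∞`. -/
def IsQuasiGreedy (M : ℕ) (q x : ℝ) (d : Digits M) : Prop :=
  piQ M q d = x ∧ ¬ EndsInZero d ∧
    ∀ e : Digits M, piQ M q e = x → ¬ EndsInZero e → lexLe e d

/-- `Φ_x(q)`: the quasi-greedy `q`-expansion of `x` (junk value if none exists). -/
noncomputable def Phi (M : ℕ) (x q : ℝ) : Digits M :=
  if h : ∃ d : Digits M, IsQuasiGreedy M q x d then h.choose else fun _ => 0

/-- `𝐔(x) = {Φ_x(q) : q ∈ 𝒰(x)}`. -/
def UxSym (M : ℕ) (x : ℝ) : Set (Digits M) := (Phi M x) '' (Ubases M x)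

/-- `ρ((c_i),(d_i)) = (M+1)^{-inf{i ≥ 1 : c_i ≠ d_i}}` (our index `n` represents the
`(n+1)`-st digit, whence the exponent `-(n+1)`); `ρ(c,c) = 0`. -/
noncomputable def rho (M : ℕ) (c d : Digits M) : ℝ :=
  if c = d then 0
  else ((M : ℝ) + 1) ^ (-(((sInf {i | c i ≠ d i} : ℕ) : ℤ) + 1))

/-- Diameter of a set with respect to a distance function, valued in `ℝ≥0∞`. -/
noncomputable def gdiam {X : Type*} (dist : X → X → ℝ) (A : Set X) : ℝ≥0∞ :=
  ⨆ x ∈ A, ⨆ y ∈ A, ENNReal.ofReal (dist x y)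

/-- The `s`-dimensional Hausdorff outer measure with respect to a distance function:
`lim_{δ→0⁺} inf {Σ diam(C n)^s : A ⊆ ⋃ C n, diam (C n) ≤ δ}`. -/
noncomputable def gHMeasure {X : Type*} (dist : X → X → ℝ) (s : ℝ) (A : Set X) : ℝ≥0∞ :=
  ⨆ (δ : ℝ) (_ : 0 < δ),
    ⨅ (C : ℕ → Set X) (_ : A ⊆ ⋃ n, C n)
      (_ : ∀ n, gdiam dist (C n) ≤ ENNReal.ofReal δ),
      ∑' n, gdiam dist (C n) ^ s

/-- Hausdorff dimension with respect to a distance function. -/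
noncomputable def gdimH {X : Type*} (dist : X → X → ℝ) (A : Set X) : ℝ≥0∞ :=
  ⨆ (s : ℝ≥0) (_ : gHMeasure dist (s : ℝ) A = ⊤), (s : ℝ≥0∞)

/-- The generalized golden ratio `q_G`. -/
noncomputable def qG (M : ℕ) : ℝ :=
  if M % 2 = 0 then ((M / 2 : ℕ) : ℝ) + 1
  else (((M / 2 : ℕ) : ℝ) + 1 +
    Real.sqrt (((M / 2 : ℕ) : ℝ) ^ 2 + 6 * ((M / 2 : ℕ) : ℝ) + 5)) / 2

/-- `x_G = M/(q_G - 1)`. -/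
noncomputable def xG (M : ℕ) : ℝ := (M : ℝ) / (qG M - 1)

/-- The Komornik–Loreti constant `q_KL = min 𝒰(1)`. -/
noncomputable def qKL (M : ℕ) : ℝ := sInf (Ubases M 1)

/-- `x_KL = M/(q_KL - 1)`. -/
noncomputable def xKL (M : ℕ) : ℝ := (M : ℝ) / (qKL M - 1)

/-- `X_iso`: the set of `x > 0` such that `𝒰(x)` contains an isolated point. -/
def Xiso (M : ℕ) : Set ℝ :=
  {x | 0 < x ∧ ∃ q ∈ Ubases M x, ∃ ε > 0, Ubases M x ∩ Set.Ioo (q - ε) (q + ε) = {q}}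

/-- The bifurcation set `𝒱 = {q ∈ (1,M+1] : 𝐔_r ≠ 𝐔_q for all r > q}`. -/
def Vset (M : ℕ) : Set ℝ :=
  {q | q ∈ Set.Ioc (1 : ℝ) ((M : ℝ) + 1) ∧
    ∀ r ∈ Set.Ioc (1 : ℝ) ((M : ℝ) + 1), q < r → UqSym M r ≠ UqSym M q}

/-- The Thue–Morse sequence `τ_i` = parity of the binary digit sum of `i`. -/
def tm (i : ℕ) : ℕ := (Nat.digits 2 i).sum % 2

/-! ### The metric on digit sequences and its Hausdorff dimension -/

/-- Digit sequences, carrying the metric `rho`. -/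
def MetricDigits (M : ℕ) := Digits M

lemma rho_nonneg (M : ℕ) (c d : Digits M) : 0 ≤ rho M c d := by
  unfold rho; split_ifs <;> positivity

lemma rho_self (M : ℕ) (c : Digits M) : rho M c c = 0 := by simp [rho]

lemma rho_comm (M : ℕ) (c d : Digits M) : rho M c d = rho M d c := by
  unfold rho
  simp only [eq_comm (a := c) (b := d), ne_comm]

lemma rho_le_of_agree {M : ℕ} {n : ℕ} {c d : Digits M} (h : ∀ i < n, c i = d i) :
    rho M c d ≤ ((M : ℝ) + 1) ^ (-((n : ℤ) + 1)) := by
  unfold rho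
  split_ifs with hcd
  · positivity
  · have hne : {i | c i ≠ d i}.Nonempty := by
      by_contra hc
      rw [Set.not_nonempty_iff_eq_empty] at hc
      exact hcd (funext fun i => by
        by_contra hi
        exact (hc ▸ (show i ∈ {i | c i ≠ d i} from hi) : i ∈ (∅ : Set ℕ)))
    have h1 := Nat.sInf_mem hne
    have h2 : n ≤ sInf {i | c i ≠ d i} := by
      by_contra hlt
      exact h1 (h _ (not_le.mp hlt))
    apply zpow_le_zpow_right₀
    · have : (0 : ℝ) ≤ M := by positivity
      linarith
    · omega

lemma le_rho_of_ne {M : ℕ} {n : ℕ} {c d : Digits M} (h : c n ≠ d n) :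
    ((M : ℝ) + 1) ^ (-((n : ℤ) + 1)) ≤ rho M c d := by
  unfold rho
  rw [if_neg (fun hcd => h (by rw [hcd]))]
  have h2 : sInf {i | c i ≠ d i} ≤ n := Nat.sInf_le h
  apply zpow_le_zpow_right₀
  · have : (0 : ℝ) ≤ M := by positivity
    linarith
  · omega

lemma exists_agree_of_ne {M : ℕ} {c d : Digits M} (h : c ≠ d) :
    ∃ n, (∀ i < n, c i = d i) ∧ c n ≠ d n := by
  have h' : ∃ n, c n ≠ d n := by
    by_contra hc
    push Not at hc
    exact h (funext hc)
  exact ⟨Nat.find h', fun i hi => by simpa using Nat.find_min h' hi, Nat.find_spec h'⟩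

lemma rho_triangle (M : ℕ) (c d e : Digits M) : rho M c e ≤ rho M c d + rho M d e := by
  by_cases hce : c = e
  · subst hce
    rw [rho_self]
    have h1 := rho_nonneg M c d
    have h2 := rho_nonneg M d c
    linarith
  · obtain ⟨n, hn, hn'⟩ := exists_agree_of_ne hce
    have h0 := rho_le_of_agree hn
    by_cases hcd : c n = d n
    · have := le_rho_of_ne (M := M) (n := n) (c := d) (d := e) (by rwa [← hcd])
      linarith [rho_nonneg M c d]
    · have := le_rho_of_ne hcd
      linarith [rho_nonneg M d e]

lemma eq_of_rho_eq_zero {M : ℕ} {c d : Digits M} (h : rho M c d = 0) : c = d := by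
  by_contra hcd
  obtain ⟨n, -, hn⟩ := exists_agree_of_ne hcd
  have h1 := le_rho_of_ne hn
  have : (0 : ℝ) < ((M : ℝ) + 1) ^ (-((n : ℤ) + 1)) := by positivity
  linarith

noncomputable instance (M : ℕ) : MetricSpace (MetricDigits M) where
  dist := rho M
  dist_self := rho_self M
  dist_comm := rho_comm M
  dist_triangle := rho_triangle M
  eq_of_dist_eq_zero := eq_of_rho_eq_zero

noncomputable instance (M : ℕ) : MeasurableSpace (MetricDigits M) := borel _
instance (M : ℕ) : BorelSpace (MetricDigits M) := ⟨rfl⟩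

lemma edist_eq_rho {M : ℕ} (c d : MetricDigits M) : edist c d = ENNReal.ofReal (rho M c d) :=
  edist_dist c d

lemma gdiam_eq_ediam (M : ℕ) (A : Set (Digits M)) :
    gdiam (rho M) A = Metric.ediam (X := MetricDigits M) A := by
  unfold gdiam Metric.ediam
  simp only [edist_eq_rho]
  rfl

lemma gHMeasure_eq_hausdorffMeasure {M : ℕ} {s : ℝ} (hs : 0 < s) (A : Set (Digits M)) :
    gHMeasure (rho M) s A =
      MeasureTheory.Measure.hausdorffMeasure (X := MetricDigits M) s A := by
  have key : ∀ C : ℕ → Set (Digits M),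
      ∑' n, gdiam (rho M) (C n) ^ s =
        ∑' n, ⨆ (_ : (C n).Nonempty), Metric.ediam (X := MetricDigits M) (C n) ^ s := by
    intro C
    refine tsum_congr fun n => ?_
    rw [gdiam_eq_ediam]
    rcases (C n).eq_empty_or_nonempty with h | h
    · rw [h]
      have : Metric.ediam (X := MetricDigits M) (∅ : Set (MetricDigits M)) = 0 :=
        Metric.ediam_empty
      erw [this, ENNReal.zero_rpow_of_pos hs]
      simp
    · simp [h]
  erw [MeasureTheory.Measure.hausdorffMeasure_apply (X := MetricDigits M)]
  unfold gHMeasure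
  simp only [key]
  simp only [gdiam_eq_ediam]
  apply le_antisymm
  · refine iSup₂_le fun δ hδ => ?_
    exact le_iSup₂_of_le (ENNReal.ofReal δ) (by simpa using hδ) le_rfl
  · refine iSup₂_le fun r hr => ?_
    by_cases hr' : r = ⊤
    · refine le_iSup₂_of_le 1 one_pos ?_
      refine le_iInf fun C => le_iInf fun hC => le_iInf fun hC' => ?_
      exact iInf_le_of_le C (iInf_le_of_le hC (iInf_le_of_le (fun n => by simp [hr']) le_rfl))
    · refine le_iSup₂_of_le r.toReal (ENNReal.toReal_pos hr.ne' hr') ?_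
      rw [ENNReal.ofReal_toReal hr']
      exact le_rfl

lemma gdimH_eq_dimH (M : ℕ) (A : Set (Digits M)) :
    gdimH (rho M) A = dimH (X := MetricDigits M) A := by
  refine Eq.trans ?_ (dimH_def (X := MetricDigits M) A).symm
  unfold gdimH
  apply le_antisymm
  · refine iSup₂_le fun s hs => ?_
    rcases (zero_le : 0 ≤ s).eq_or_lt with h | h
    · simp [← h]
    · rw [gHMeasure_eq_hausdorffMeasure (by exact_mod_cast h)] at hs
      exact le_iSup₂_of_le s hs le_rfl
  · refine iSup₂_le fun s hs => ?_
    rcases (zero_le : 0 ≤ s).eq_or_lt with h | h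
    · simp [← h]
    · rw [← gHMeasure_eq_hausdorffMeasure (by exact_mod_cast h)] at hs
      exact le_iSup₂_of_le s hs le_rfl

lemma gdimH_mono {M : ℕ} {A B : Set (Digits M)} (h : A ⊆ B) :
    gdimH (rho M) A ≤ gdimH (rho M) B := by
  rw [gdimH_eq_dimH, gdimH_eq_dimH]
  exact dimH_mono (X := MetricDigits M) h

lemma gdimH_iUnion_le {M : ℕ} {ι : Type*} [Countable ι] {A : ι → Set (Digits M)} {t : ℝ≥0∞}
    (h : ∀ i, gdimH (rho M) (A i) ≤ t) : gdimH (rho M) (⋃ i, A i) ≤ t := by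
  rw [gdimH_eq_dimH]
  erw [dimH_iUnion (X := MetricDigits M)]
  exact iSup_le fun i => (gdimH_eq_dimH M (A i)) ▸ h i

lemma gdimH_union_le {M : ℕ} {A B : Set (Digits M)} {t : ℝ≥0∞}
    (hA : gdimH (rho M) A ≤ t) (hB : gdimH (rho M) B ≤ t) : gdimH (rho M) (A ∪ B) ≤ t := by
  rw [Set.union_eq_iUnion]
  exact gdimH_iUnion_le fun b => by cases b <;> simpa

lemma gdimH_countable {M : ℕ} {A : Set (Digits M)} (h : A.Countable) : gdimH (rho M) A = 0 := by
  rw [gdimH_eq_dimH]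
  exact dimH_countable (X := MetricDigits M) h

/-- The `k`-fold left shift. -/
def shift {M : ℕ} (k : ℕ) (x : Digits M) : Digits M := fun i => x (i + k)

/-- The word formed by the first `n` digits of `v`, followed by the sequence `x`. -/
def splice {M : ℕ} (n : ℕ) (v x : Digits M) : Digits M :=
  fun i => if i < n then v i else x (i - n)

@[simp] lemma shift_zero {M : ℕ} (x : Digits M) : shift 0 x = x := rfl

@[simp] lemma shift_shift {M : ℕ} (j k : ℕ) (x : Digits M) :
    shift j (shift k x) = shift (j + k) x := by
  funext i; simp [shift, add_assoc]

@[simp] lemma shift_splice {M : ℕ} (n : ℕ) (v x : Digits M) : shift n (splice n v x) = x := by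
  funext i; simp [shift, splice]

lemma splice_shift {M : ℕ} (n : ℕ) (x : Digits M) : splice n x (shift n x) = x := by
  funext i
  simp only [splice, shift]
  split_ifs with h
  · rfl
  · congr 1; omega

lemma shift_splice_of_le {M : ℕ} {k n : ℕ} (h : k ≤ n) (v x : Digits M) :
    shift k (splice n v x) = splice (n - k) (shift k v) x := by
  funext i
  simp only [shift, splice]
  by_cases hi : i + k < n
  · rw [if_pos hi, if_pos (by omega)]
  · rw [if_neg hi, if_neg (by omega)]
    congr 1; omega

lemma splice_congr {M : ℕ} {n : ℕ} {v w : Digits M} (h : ∀ i < n, v i = w i) (x : Digits M) :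
    splice n v x = splice n w x := by
  funext i
  simp only [splice]
  split_ifs with hi
  · exact h i hi
  · rfl

lemma gdimH_shift_image_le {M : ℕ} (k : ℕ) (A : Set (Digits M)) :
    gdimH (rho M) (shift k '' A) ≤ gdimH (rho M) A := by
  rw [gdimH_eq_dimH, gdimH_eq_dimH]
  have hL : LipschitzWith (α := MetricDigits M) (β := MetricDigits M) (((M : ℝ≥0) + 1) ^ k)
      (shift k) := by
    refine LipschitzWith.of_dist_le_mul fun x y => ?_
    change rho M (shift k x) (shift k y) ≤ _ * rho M x y
    by_cases hxy : shift k x = shift k y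
    · erw [hxy, rho_self]
      exact mul_nonneg (by positivity) (rho_nonneg _ _ _)
    · obtain ⟨n, hn, hn'⟩ := exists_agree_of_ne hxy
      have h1 := rho_le_of_agree hn
      have h2 := le_rho_of_ne (c := x) (d := y) (n := n + k) hn'
      have h3 : ((M : ℝ) + 1) ^ (-((n : ℤ) + 1)) =
          ((M : ℝ) + 1) ^ k * ((M : ℝ) + 1) ^ (-(((n + k : ℕ) : ℤ) + 1)) := by
        rw [← zpow_natCast, ← zpow_add₀ (by positivity)]
        congr 1; push_cast; ring
      refine h1.trans ?_
      rw [h3]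
      push_cast
      exact mul_le_mul_of_nonneg_left (by simpa using h2) (by positivity)
  exact LipschitzWith.dimH_image_le (X := MetricDigits M) (Y := MetricDigits M) hL A

lemma gdimH_splice_image_le {M : ℕ} (n : ℕ) (v : Digits M) (A : Set (Digits M)) :
    gdimH (rho M) (splice n v '' A) ≤ gdimH (rho M) A := by
  rw [gdimH_eq_dimH, gdimH_eq_dimH]
  have hL : LipschitzWith (α := MetricDigits M) (β := MetricDigits M) 1 (splice n v) := by
    refine LipschitzWith.of_dist_le_mul fun x y => ?_
    change rho M (splice n v x) (splice n v y) ≤ _ * rho M x y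
    simp only [NNReal.coe_one, one_mul]
    by_cases hxy : x = y
    · rw [hxy, rho_self]
      exact rho_nonneg _ _ _
    · obtain ⟨m, hm, hm'⟩ := exists_agree_of_ne (M := M) hxy
      refine (rho_le_of_agree (n := m) fun i hi => ?_).trans (le_rho_of_ne hm')
      simp only [splice]
      split_ifs
      · rfl
      · exact hm _ (by omega)
  exact LipschitzWith.dimH_image_le (X := MetricDigits M) (Y := MetricDigits M) hL A

lemma gdimH_shift_preimage_le {M : ℕ} (k : ℕ) (A : Set (Digits M)) :
    gdimH (rho M) (shift k ⁻¹' A) ≤ gdimH (rho M) A := by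
  have hsub : shift k ⁻¹' A ⊆ ⋃ v : Fin k → Fin (M + 1),
      splice k (fun i => if h : i < k then v ⟨i, h⟩ else 0 : Digits M) '' A := by
    intro x hx
    rw [Set.mem_iUnion]
    refine ⟨fun i => x i, shift k x, hx, ?_⟩
    rw [splice_congr (w := x) (fun i hi => by simp [hi]), splice_shift]
  exact (gdimH_mono hsub).trans (gdimH_iUnion_le fun v => gdimH_splice_image_le _ _ _)

/-- Small covers below the dimension. -/
lemma exists_small_cover {M : ℕ} {A : Set (Digits M)} {s : ℝ≥0} (hs : gdimH (rho M) A < s)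
    {ε : ℝ≥0∞} (hε : 0 < ε) :
    ∃ C : ℕ → Set (Digits M), A ⊆ ⋃ n, C n ∧ ∑' n, gdiam (rho M) (C n) ^ (s : ℝ) < ε := by
  have hs0 : (0 : ℝ) < s := by
    have : (0 : ℝ≥0∞) < s := pos_of_gt hs
    exact_mod_cast this
  have h0 : gHMeasure (rho M) s A = 0 := by
    rw [gHMeasure_eq_hausdorffMeasure hs0]
    rw [gdimH_eq_dimH] at hs
    exact hausdorffMeasure_of_dimH_lt (X := MetricDigits M) hs
  have h1 : (⨅ (C : ℕ → Set (Digits M)) (_ : A ⊆ ⋃ n, C n)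
      (_ : ∀ n, gdiam (rho M) (C n) ≤ ENNReal.ofReal 1),
      ∑' n, gdiam (rho M) (C n) ^ (s : ℝ)) ≤ 0 := by
    rw [← h0]
    exact le_iSup₂_of_le (f := fun (δ : ℝ) (_ : 0 < δ) =>
      ⨅ (C : ℕ → Set (Digits M)) (_ : A ⊆ ⋃ n, C n)
      (_ : ∀ n, gdiam (rho M) (C n) ≤ ENNReal.ofReal δ),
      ∑' n, gdiam (rho M) (C n) ^ (s : ℝ)) 1 one_pos le_rfl
  have h2 := lt_of_le_of_lt h1 hε
  simp only [iInf_lt_iff] at h2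
  obtain ⟨C, hC, -, hlt⟩ := h2
  exact ⟨C, hC, hlt⟩

/-! ### Words, the lexicographic order and counting -/

/-- The first `n` digits of `x`, read as an integer in base `M + 1`. -/
def wordVal {M : ℕ} : ℕ → Digits M → ℕ
  | 0, _ => 0
  | n + 1, x => wordVal n x * (M + 1) + x n

/-- Digitwise reflection. -/
def refl {M : ℕ} (x : Digits M) : Digits M := fun i => Fin.rev (x i)

@[simp] lemma refl_refl {M : ℕ} (x : Digits M) : refl (refl x) = x := by
  funext i; simp [refl]

@[simp] lemma refl_shift {M : ℕ} (k : ℕ) (x : Digits M) : refl (shift k x) = shift k (refl x) :=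
  rfl

lemma refl_splice {M : ℕ} (n : ℕ) (v x : Digits M) :
    refl (splice n v x) = splice n (refl v) (refl x) := by
  funext i; simp only [refl, splice]; split_ifs <;> rfl

lemma refl_val {M : ℕ} (x : Digits M) (i : ℕ) : (refl x i : ℕ) + x i = M := by
  have := (x i).isLt
  simp only [refl, Fin.val_rev]; omega

@[simp] lemma wordVal_zero {M : ℕ} (x : Digits M) : wordVal 0 x = 0 := rfl

lemma wordVal_succ {M : ℕ} (n : ℕ) (x : Digits M) :
    wordVal (n + 1) x = wordVal n x * (M + 1) + x n := rfl

lemma wordVal_lt {M : ℕ} (n : ℕ) (x : Digits M) : wordVal n x < (M + 1) ^ n := by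
  induction n with
  | zero => simp
  | succ n ih =>
    have := (x n).isLt
    rw [wordVal_succ, pow_succ]
    nlinarith

lemma wordVal_congr {M : ℕ} {n : ℕ} {x y : Digits M} (h : ∀ i < n, x i = y i) :
    wordVal n x = wordVal n y := by
  induction n with
  | zero => rfl
  | succ n ih =>
    rw [wordVal_succ, wordVal_succ, ih fun i hi => h i (by omega), h n (by omega)]

lemma wordVal_succ_div {M : ℕ} (n : ℕ) (x : Digits M) :
    wordVal (n + 1) x / (M + 1) = wordVal n x := by
  have := (x n).isLt
  rw [wordVal_succ, mul_comm, Nat.mul_add_div (by omega), Nat.div_eq_of_lt this, add_zero]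

lemma wordVal_succ_mod {M : ℕ} (n : ℕ) (x : Digits M) :
    wordVal (n + 1) x % (M + 1) = x n := by
  have := (x n).isLt
  rw [wordVal_succ, mul_comm, Nat.mul_add_mod, Nat.mod_eq_of_lt this]

lemma wordVal_eq_iff {M : ℕ} {n : ℕ} {x y : Digits M} :
    wordVal n x = wordVal n y ↔ ∀ i < n, x i = y i := by
  refine ⟨fun h => ?_, wordVal_congr⟩
  induction n with
  | zero => simp
  | succ n ih =>
    intro i hi
    rcases Nat.lt_succ_iff_lt_or_eq.mp hi with hi | rfl
    · exact ih (by rw [← wordVal_succ_div, h, wordVal_succ_div]) i hi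
    · exact Fin.ext (by rw [← wordVal_succ_mod, h, wordVal_succ_mod])

lemma wordVal_add {M : ℕ} (m n : ℕ) (x : Digits M) :
    wordVal (m + n) x = wordVal m x * (M + 1) ^ n + wordVal n (shift m x) := by
  induction n with
  | zero => simp
  | succ n ih =>
    rw [← add_assoc, wordVal_succ, ih, wordVal_succ, pow_succ]
    simp only [shift, add_comm n m]
    ring

lemma wordVal_refl {M : ℕ} (n : ℕ) (x : Digits M) :
    wordVal n x + wordVal n (refl x) + 1 = (M + 1) ^ n := by
  induction n with
  | zero => simp
  | succ n ih =>
    have := refl_val x n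
    rw [wordVal_succ, wordVal_succ, pow_succ, ← ih]
    nlinarith

lemma wordVal_le_of_succ_le {M : ℕ} {n : ℕ} {x y : Digits M}
    (h : wordVal (n + 1) x ≤ wordVal (n + 1) y) : wordVal n x ≤ wordVal n y := by
  rw [← wordVal_succ_div, ← wordVal_succ_div n y]
  exact Nat.div_le_div_right h

lemma wordVal_le_of_le {M : ℕ} {m n : ℕ} (hmn : m ≤ n) {x y : Digits M}
    (h : wordVal n x ≤ wordVal n y) : wordVal m x ≤ wordVal m y := by
  induction n, hmn using Nat.le_induction with
  | base => exact h
  | succ n _ ih => exact ih (wordVal_le_of_succ_le h)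

/-- The (non-strict) lexicographic order, expressed through integer values of prefixes. -/
def WordLe {M : ℕ} (x y : Digits M) : Prop := ∀ n, wordVal n x ≤ wordVal n y

lemma wordLe_refl {M : ℕ} (x : Digits M) : WordLe x x := fun _ => le_rfl

lemma WordLe.trans {M : ℕ} {x y z : Digits M} (h : WordLe x y) (h' : WordLe y z) : WordLe x z :=
  fun n => (h n).trans (h' n)

lemma WordLe.refl_anti {M : ℕ} {x y : Digits M} (h : WordLe x y) :
    WordLe (refl y) (refl x) := fun n => by
  have := wordVal_refl n x
  have := wordVal_refl n y
  have := h n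
  omega

lemma wordVal_lt_of_lt {M : ℕ} {n m : ℕ} {x y : Digits M} (h : ∀ i < n, x i = y i)
    (hn : x n < y n) (hm : n < m) : wordVal m x < wordVal m y := by
  by_contra hc
  have h1 := wordVal_le_of_le (show n + 1 ≤ m from hm) (not_lt.mp hc)
  rw [wordVal_succ, wordVal_succ, wordVal_congr h] at h1
  have : (x n : ℕ) < y n := hn
  omega

lemma wordLe_of_lt {M : ℕ} {n : ℕ} {x y : Digits M} (h : ∀ i < n, x i = y i)
    (hn : x n < y n) : WordLe x y := fun m => by
  rcases lt_or_ge n m with hm | hm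
  · exact (wordVal_lt_of_lt h hn hm).le
  · exact (wordVal_congr fun i hi => h i (by omega)).le

lemma WordLe.exists_lt {M : ℕ} {x y : Digits M} (h : WordLe x y) (hne : x ≠ y) :
    ∃ n, (∀ i < n, x i = y i) ∧ x n < y n := by
  obtain ⟨n, hn, hn'⟩ := exists_agree_of_ne hne
  refine ⟨n, hn, lt_of_le_of_ne ?_ hn'⟩
  have := h (n + 1)
  rw [wordVal_succ, wordVal_succ, wordVal_congr hn] at this
  exact Fin.le_def.mpr (by omega)

lemma exists_lt_of_not_wordLe {M : ℕ} {x y : Digits M} (h : ¬ WordLe x y) :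
    ∃ n, (∀ i < n, x i = y i) ∧ y n < x n := by
  have hne : x ≠ y := by rintro rfl; exact h (wordLe_refl _)
  obtain ⟨n, hn, hn'⟩ := exists_agree_of_ne hne
  refine ⟨n, hn, lt_of_le_of_ne (not_lt.mp fun hlt => h (wordLe_of_lt hn hlt)) (Ne.symm hn')⟩

lemma WordLe.antisymm {M : ℕ} {x y : Digits M} (h : WordLe x y) (h' : WordLe y x) : x = y :=
  funext fun i => wordVal_eq_iff.mp ((h (i + 1)).antisymm (h' (i + 1))) i (by omega)

lemma WordLe.head_le {M : ℕ} {x y : Digits M} (h : WordLe x y) : x 0 ≤ y 0 := by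
  have := h 1
  rw [wordVal_succ, wordVal_succ] at this
  exact Fin.le_def.mpr (by simpa using this)

lemma continuous_wordVal {M : ℕ} (n : ℕ) : Continuous (wordVal n : Digits M → ℕ) := by
  induction n with
  | zero => exact continuous_const
  | succ n ih =>
    have h1 : Continuous fun x : Digits M => ((x n : Fin (M + 1)) : ℕ) :=
      (continuous_of_discreteTopology (f := fun a : Fin (M + 1) => (a : ℕ))).comp
        (continuous_apply n)
    exact (ih.mul continuous_const).add h1

lemma isOpen_cylinder {M : ℕ} (n w : ℕ) : IsOpen {x : Digits M | wordVal n x = w} :=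
  (isOpen_discrete {w}).preimage (continuous_wordVal n)

lemma continuous_shift {M : ℕ} (k : ℕ) : Continuous (shift k : Digits M → Digits M) :=
  continuous_pi fun i => continuous_apply (i + k)

lemma continuous_refl {M : ℕ} : Continuous (refl : Digits M → Digits M) :=
  continuous_pi fun i =>
    (continuous_of_discreteTopology (f := fun a : Fin (M + 1) => Fin.rev a)).comp
      (continuous_apply i)

lemma isClosed_wordLe {M : ℕ} (y : Digits M) : IsClosed {x : Digits M | WordLe x y} := by
  simp only [WordLe, Set.ofPred_forall]
  exact isClosed_iInter fun n => isClosed_le (continuous_wordVal n) continuous_const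

lemma finite_image_wordVal {M : ℕ} (n : ℕ) (X : Set (Digits M)) : (wordVal n '' X).Finite :=
  (Set.finite_Iio ((M + 1) ^ n)).subset (by rintro _ ⟨x, -, rfl⟩; exact wordVal_lt n x)

/-- A nonempty compact set of sequences has a lexicographically largest element. -/
lemma exists_lexmax {M : ℕ} {X : Set (Digits M)} (hX : IsClosed X) (hne : X.Nonempty) :
    ∃ α ∈ X, ∀ x ∈ X, WordLe x α := by
  let K : ℕ → Set (Digits M) := fun n => X ∩ {x | ∀ y ∈ X, wordVal n y ≤ wordVal n x}
  have hcl : ∀ n, IsClosed (K n) := fun n => by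
    refine hX.inter ?_
    simp only [Set.ofPred_forall]
    exact isClosed_iInter fun y => isClosed_iInter fun _ =>
      isClosed_le continuous_const (continuous_wordVal n)
  have hK : (⋂ n, K n).Nonempty := by
    refine IsCompact.nonempty_iInter_of_sequence_nonempty_isCompact_isClosed K ?_ ?_
      (hcl 0).isCompact hcl
    · exact fun n x hx => ⟨hx.1, fun y hy => wordVal_le_of_succ_le (hx.2 y hy)⟩
    · intro n
      obtain ⟨_, ⟨x, hx, rfl⟩, h⟩ := Set.exists_max_image _ id (finite_image_wordVal n X)
        (hne.image _)
      exact ⟨x, hx, fun y hy => h _ ⟨y, hy, rfl⟩⟩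
  obtain ⟨α, hα⟩ := hK
  rw [Set.mem_iInter] at hα
  exact ⟨α, (hα 0).1, fun x hx n => (hα n).2 x hx⟩

/-- The number of words of length `n` that start elements of `X`. -/
noncomputable def numWords {M : ℕ} (X : Set (Digits M)) (n : ℕ) : ℕ := (wordVal n '' X).ncard

lemma numWords_le {M : ℕ} (X : Set (Digits M)) (n : ℕ) : numWords X n ≤ (M + 1) ^ n := by
  have h : wordVal n '' X ⊆ ↑(Finset.range ((M + 1) ^ n)) := by
    rintro _ ⟨x, -, rfl⟩
    simpa using wordVal_lt n x
  have := Set.ncard_le_ncard h (Finset.finite_toSet _)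
  rwa [Set.ncard_coe_finset, Finset.card_range] at this

lemma gdimH_le_of_numWords_le {M : ℕ} {X : Set (Digits M)} {s : ℝ≥0} {C : ℝ}
    (h : ∀ n, (numWords X n : ℝ) * (((M : ℝ) + 1) ^ (-(s : ℝ))) ^ n ≤ C) :
    gdimH (rho M) X ≤ s := by
  rw [gdimH_eq_dimH]
  rcases Nat.eq_zero_or_pos M with hM0 | hM
  · subst hM0
    have : X.Subsingleton := fun x _ y _ => funext fun i => Fin.ext (by omega)
    have h0 : dimH (X := MetricDigits 0) X = 0 :=
      dimH_countable (X := MetricDigits 0) this.countable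
    rw [h0]; exact zero_le
  have hb : (1 : ℝ) < (M : ℝ) + 1 := by
    have : (0 : ℝ) < M := by exact_mod_cast hM
    linarith
  apply dimH_le_of_hausdorffMeasure_ne_top (X := MetricDigits M)
  have hfin : ∀ n, Fintype (wordVal n '' X) := fun n => (finite_image_wordVal n X).fintype
  let r : ℕ → ℝ≥0∞ := fun n => ENNReal.ofReal (((M : ℝ) + 1) ^ (-((n : ℤ) + 1)))
  have hr : Filter.Tendsto r Filter.atTop (nhds 0) := by
    have h1 : Filter.Tendsto (fun n : ℕ => ((M : ℝ) + 1)⁻¹ ^ (n + 1)) Filter.atTop (nhds 0) :=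
      (tendsto_pow_atTop_nhds_zero_of_lt_one (by positivity) (inv_lt_one_of_one_lt₀ hb)).comp
        (Filter.tendsto_add_atTop_nat 1)
    have h2 := ENNReal.tendsto_ofReal h1
    rw [ENNReal.ofReal_zero] at h2
    refine h2.congr fun n => ?_
    simp only [r]
    rw [zpow_neg, inv_pow]
    norm_cast
  have hdiam : ∀ n (w : wordVal n '' X),
      Metric.ediam (X := MetricDigits M) {x : Digits M | wordVal n x = w} ≤ r n := by
    intro n w
    refine (gdiam_eq_ediam M {x : Digits M | wordVal n x = w}).symm.trans_le ?_
    refine iSup₂_le fun x hx => iSup₂_le fun y hy => ENNReal.ofReal_le_ofReal ?_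
    exact rho_le_of_agree (wordVal_eq_iff.mp (hx.trans hy.symm))
  have key := MeasureTheory.Measure.hausdorffMeasure_le_liminf_sum (X := MetricDigits M)
    (ι := fun n => (wordVal n '' X)) s X (l := Filter.atTop) r hr
    (fun n w => {x : Digits M | wordVal n x = w})
    (Filter.Eventually.of_forall hdiam)
    (Filter.Eventually.of_forall fun n x hx => Set.mem_iUnion.mpr ⟨⟨_, x, hx, rfl⟩, rfl⟩)
  refine ne_top_of_le_ne_top ?_ (key.trans (Filter.liminf_le_of_le (a := ENNReal.ofReal C)
    ⟨0, by simp⟩ fun c hc => ?_))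
  · exact ENNReal.ofReal_ne_top
  · obtain ⟨n, hn⟩ := hc.exists
    refine hn.trans ?_
    calc ∑ w : wordVal n '' X,
          Metric.ediam (X := MetricDigits M) {x : Digits M | wordVal n x = w} ^ (s : ℝ)
        ≤ ∑ w : wordVal n '' X, r n ^ (s : ℝ) :=
          Finset.sum_le_sum fun w _ => ENNReal.rpow_le_rpow (hdiam n w) s.coe_nonneg
      _ = numWords X n * r n ^ (s : ℝ) := by
          rw [Finset.sum_const, nsmul_eq_mul, numWords, Finset.card_univ,
            ← Nat.card_eq_fintype_card, Nat.card_coe_set_eq]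
      _ ≤ ENNReal.ofReal C := by
          simp only [r]
          rw [ENNReal.ofReal_rpow_of_nonneg (by positivity) s.coe_nonneg, ← ENNReal.ofReal_natCast,
            ← ENNReal.ofReal_mul (by positivity)]
          refine ENNReal.ofReal_le_ofReal (le_trans ?_ (h n))
          refine mul_le_mul_of_nonneg_left ?_ (by positivity)
          rw [← Real.rpow_natCast, ← Real.rpow_intCast, ← Real.rpow_mul (by positivity),
            ← Real.rpow_mul (by positivity)]
          refine Real.rpow_le_rpow_of_exponent_le hb.le ?_
          push_cast
          nlinarith [s.coe_nonneg, (show (0:ℝ) ≤ s from s.coe_nonneg)]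

lemma numWords_mul_pow_le {M : ℕ} {Y : Set (Digits M)} (hY : ∀ k, ∀ x ∈ Y, shift k x ∈ Y)
    {z : ℝ} (hz : 0 < z) (hz1 : z ≤ 1) {ι : Type*} (t : Finset ι) (ℓ w : ι → ℕ)
    (hℓ : ∀ i ∈ t, 1 ≤ ℓ i) (hsum : ∑ i ∈ t, z ^ ℓ i ≤ 1)
    (hcov : ∀ x ∈ Y, ∃ i ∈ t, wordVal (ℓ i) x = w i) :
    ∃ C : ℝ, ∀ n, (numWords Y n : ℝ) * z ^ n ≤ C := by
  let L := ∑ i ∈ t, ℓ i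
  have hL : ∀ i ∈ t, ℓ i ≤ L := fun i hi => Finset.single_le_sum (f := ℓ) (by simp) hi
  refine ⟨((M : ℝ) + 1) ^ L, fun n => ?_⟩
  induction n using Nat.strong_induction_on with
  | _ n ih =>
  rcases lt_or_ge n L with hn | hn
  · calc (numWords Y n : ℝ) * z ^ n ≤ ((M : ℝ) + 1) ^ n * 1 := by
          gcongr
          · exact_mod_cast numWords_le Y n
          · exact pow_le_one₀ hz.le hz1
      _ ≤ ((M : ℝ) + 1) ^ L := by
          rw [mul_one]
          exact pow_le_pow_right₀ (by have : (0:ℝ) ≤ M := by positivity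
                                      linarith) hn.le
  · have hsub : wordVal n '' Y ⊆ ⋃ i ∈ t,
        (fun u => w i * (M + 1) ^ (n - ℓ i) + u) '' (wordVal (n - ℓ i) '' Y) := by
      rintro _ ⟨x, hx, rfl⟩
      obtain ⟨i, hi, hw⟩ := hcov x hx
      have hle := (hL i hi).trans hn
      simp only [Set.mem_iUnion]
      refine ⟨i, hi, _, ⟨_, hY (ℓ i) x hx, rfl⟩, ?_⟩
      simp only
      rw [← hw, ← wordVal_add, Nat.add_sub_cancel' hle]
    have hcard : numWords Y n ≤ ∑ i ∈ t, numWords Y (n - ℓ i) := by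
      refine (Set.ncard_le_ncard hsub ?_).trans ?_
      · exact t.finite_toSet.biUnion fun i _ => (finite_image_wordVal _ _).image _
      · refine (Finset.set_ncard_biUnion_le t _).trans (Finset.sum_le_sum fun i _ => ?_)
        exact Set.ncard_image_le (finite_image_wordVal _ _)
    calc (numWords Y n : ℝ) * z ^ n ≤ (∑ i ∈ t, (numWords Y (n - ℓ i) : ℝ)) * z ^ n := by
          gcongr
          exact_mod_cast hcard
      _ = ∑ i ∈ t, z ^ ℓ i * ((numWords Y (n - ℓ i) : ℝ) * z ^ (n - ℓ i)) := by
          rw [Finset.sum_mul]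
          refine Finset.sum_congr rfl fun i hi => ?_
          have : z ^ n = z ^ ℓ i * z ^ (n - ℓ i) := by
            rw [← pow_add, Nat.add_sub_cancel' ((hL i hi).trans hn)]
          rw [this]; ring
      _ ≤ ∑ i ∈ t, z ^ ℓ i * ((M : ℝ) + 1) ^ L := by
          refine Finset.sum_le_sum fun i hi => mul_le_mul_of_nonneg_left ?_ (by positivity)
          refine ih _ ?_
          have := hℓ i hi
          have := (hL i hi).trans hn
          omega
      _ ≤ ((M : ℝ) + 1) ^ L := by
          rw [← Finset.sum_mul]
          exact mul_le_of_le_one_left (by positivity) hsum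

lemma gdimH_le_of_cover {M : ℕ} {Y : Set (Digits M)} (hY : ∀ k, ∀ x ∈ Y, shift k x ∈ Y)
    {s : ℝ≥0} {ι : Type*} (t : Finset ι) (ℓ w : ι → ℕ)
    (hℓ : ∀ i ∈ t, 1 ≤ ℓ i) (hsum : ∑ i ∈ t, (((M : ℝ) + 1) ^ (-(s : ℝ))) ^ ℓ i ≤ 1)
    (hcov : ∀ x ∈ Y, ∃ i ∈ t, wordVal (ℓ i) x = w i) : gdimH (rho M) Y ≤ s := by
  have hM : (0 : ℝ) ≤ M := by positivity
  obtain ⟨C, hC⟩ := numWords_mul_pow_le hY (z := ((M : ℝ) + 1) ^ (-(s : ℝ))) (by positivity)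
    (Real.rpow_le_one_of_one_le_of_nonpos (by linarith) (by simp)) t ℓ w hℓ hsum hcov
  exact gdimH_le_of_numWords_le hC

/-- A set of small diameter sits inside a cylinder of comparable diameter. -/
lemma exists_cylinder {M : ℕ} (hM : 0 < M) {s : ℝ≥0} (hs : 0 < s) {A : Set (Digits M)}
    (hA : gdiam (rho M) A ^ (s : ℝ) < ENNReal.ofReal (((M : ℝ) + 1) ^ (-(s : ℝ))))
    {η : ℝ≥0∞} (hη : 0 < η) :
    ∃ k w, 1 ≤ k ∧ A ⊆ {x | wordVal k x = w} ∧
      ENNReal.ofReal ((((M : ℝ) + 1) ^ (-(s : ℝ))) ^ k) ≤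
        ENNReal.ofReal (((M : ℝ) + 1) ^ (s : ℝ)) * gdiam (rho M) A ^ (s : ℝ) + η := by
  have hb : (1 : ℝ) < (M : ℝ) + 1 := by
    have : (0 : ℝ) < M := by exact_mod_cast hM
    linarith
  have hs' : (0 : ℝ) < s := hs
  by_cases hex : ∃ m, ∃ x ∈ A, ∃ y ∈ A, x m ≠ y m
  · obtain ⟨x, hx, y, hy, hxy⟩ := Nat.find_spec hex
    have hmin : ∀ i < Nat.find hex, ∀ u ∈ A, ∀ v ∈ A, u i = v i := by
      intro i hi u hu v hv
      by_contra hne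
      exact Nat.find_min hex hi ⟨u, hu, v, hv, hne⟩
    set m := Nat.find hex with hm
    have h1 : ENNReal.ofReal (((M : ℝ) + 1) ^ (-((m : ℤ) + 1))) ≤ gdiam (rho M) A :=
      (ENNReal.ofReal_le_ofReal (le_rho_of_ne hxy)).trans
        (le_iSup₂_of_le x hx (le_iSup₂_of_le (f := fun y (_ : y ∈ A) =>
          ENNReal.ofReal (rho M x y)) y hy le_rfl))
    have h2 : ENNReal.ofReal ((((M : ℝ) + 1) ^ (-(s : ℝ))) ^ (m + 1)) ≤
        gdiam (rho M) A ^ (s : ℝ) := by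
      refine le_trans (le_of_eq ?_) (ENNReal.rpow_le_rpow h1 s.coe_nonneg)
      rw [ENNReal.ofReal_rpow_of_nonneg (by positivity) s.coe_nonneg, ← Real.rpow_natCast,
        ← Real.rpow_intCast, ← Real.rpow_mul (by positivity), ← Real.rpow_mul (by positivity)]
      push_cast
      congr 2
      ring
    have hm1 : 1 ≤ m := by
      by_contra hm0
      have : m = 0 := by omega
      rw [this] at h2
      rw [zero_add, pow_one] at h2
      exact absurd hA (not_lt.mpr h2)
    refine ⟨m, wordVal m x, hm1, fun u hu => wordVal_congr fun i hi => hmin i hi u hu x hx, ?_⟩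
    refine le_add_right (le_trans (le_of_eq ?_) (mul_le_mul_right h2 _))
    rw [← ENNReal.ofReal_mul (by positivity)]
    congr 1
    rw [pow_succ, Real.rpow_neg (by positivity)]
    have : ((M : ℝ) + 1) ^ (s : ℝ) ≠ 0 := by positivity
    field_simp
  · push Not at hex
    have hz : ((M : ℝ) + 1) ^ (-(s : ℝ)) < 1 :=
      Real.rpow_lt_one_of_one_lt_of_neg hb (by linarith)
    have h1 := ENNReal.tendsto_ofReal ((tendsto_pow_atTop_nhds_zero_of_lt_one
      (by positivity) hz).comp (Filter.tendsto_add_atTop_nat 1))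
    rw [ENNReal.ofReal_zero] at h1
    obtain ⟨n, hn⟩ := (h1.eventually (gt_mem_nhds hη)).exists
    rcases A.eq_empty_or_nonempty with rfl | ⟨x, hx⟩
    · exact ⟨n + 1, 0, by omega, by simp, le_add_left hn.le⟩
    · exact ⟨n + 1, wordVal (n + 1) x, by omega,
        fun u hu => wordVal_congr fun i _ => hex i u hu x hx, le_add_left hn.le⟩

lemma exists_finite_cover {M : ℕ} (hM : 0 < M) {X : Set (Digits M)} (hX : IsClosed X) {s : ℝ≥0}
    (hs : gdimH (rho M) X < s) :
    ∃ (t : Finset ℕ) (ℓ w : ℕ → ℕ), (∀ i, 1 ≤ ℓ i) ∧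
      ∑ i ∈ t, (((M : ℝ) + 1) ^ (-(s : ℝ))) ^ ℓ i ≤ 1 ∧
      ∀ x ∈ X, ∃ i ∈ t, wordVal (ℓ i) x = w i := by
  have hs0 : 0 < s := by exact_mod_cast pos_of_gt hs
  set z := ((M : ℝ) + 1) ^ (-(s : ℝ)) with hz
  have hz0 : 0 < z := by positivity
  obtain ⟨C, hC, hsum⟩ := exists_small_cover hs (ε := ENNReal.ofReal (z / 2))
    (by simpa using hz0)
  obtain ⟨η, hη, hηs⟩ := ENNReal.exists_pos_sum_of_countable' (ε := ENNReal.ofReal (1 / 2))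
    (by simp) ℕ
  have hch := fun n => exists_cylinder hM hs0 (A := C n)
    (lt_of_le_of_lt (ENNReal.le_tsum n) (hsum.trans (by
      rw [ENNReal.ofReal_lt_ofReal_iff hz0]; linarith))) (hη n)
  choose ℓ w hℓ hcyl hle using hch
  obtain ⟨t, ht⟩ := hX.isCompact.elim_finite_subcover (fun n => {x | wordVal (ℓ n) x = w n})
    (fun n => isOpen_cylinder _ _) (hC.trans (Set.iUnion_mono hcyl))
  refine ⟨t, ℓ, w, hℓ, ?_, fun x hx => by simpa using ht hx⟩
  rw [← ENNReal.ofReal_le_ofReal_iff zero_le_one,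
    ENNReal.ofReal_sum_of_nonneg (fun i _ => by positivity)]
  calc ∑ i ∈ t, ENNReal.ofReal (z ^ ℓ i)
      ≤ ∑ i ∈ t, (ENNReal.ofReal (((M : ℝ) + 1) ^ (s : ℝ)) * gdiam (rho M) (C i) ^ (s : ℝ) + η i) :=
        Finset.sum_le_sum fun i _ => hle i
    _ ≤ ∑' i, (ENNReal.ofReal (((M : ℝ) + 1) ^ (s : ℝ)) * gdiam (rho M) (C i) ^ (s : ℝ) + η i) :=
        ENNReal.sum_le_tsum _
    _ = ENNReal.ofReal (((M : ℝ) + 1) ^ (s : ℝ)) * ∑' i, gdiam (rho M) (C i) ^ (s : ℝ) +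
        ∑' i, η i := by
        rw [ENNReal.tsum_add, ENNReal.tsum_mul_left]
    _ ≤ ENNReal.ofReal (((M : ℝ) + 1) ^ (s : ℝ)) * ENNReal.ofReal (z / 2) +
        ENNReal.ofReal (1 / 2) := by
        gcongr
    _ = ENNReal.ofReal 1 := by
        rw [← ENNReal.ofReal_mul (by positivity),
          ← ENNReal.ofReal_add (by positivity) (by positivity)]
        congr 1
        rw [hz, Real.rpow_neg (by positivity)]
        have : ((M : ℝ) + 1) ^ (s : ℝ) ≠ 0 := by positivity
        field_simp
        norm_num

/-! ### Values of digit sequences -/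

lemma digit_le {M : ℕ} (x : Digits M) (i : ℕ) : (x i : ℝ) ≤ M := by
  have := (x i).isLt
  exact_mod_cast (by omega : (x i : ℕ) ≤ M)

lemma summable_geom {q : ℝ} (hq : 1 < q) (a : ℝ) : Summable fun i : ℕ => a / q ^ (i + 1) := by
  have h : Summable fun i : ℕ => (a / q) * q⁻¹ ^ i :=
    (summable_geometric_of_lt_one (by positivity) (inv_lt_one_of_one_lt₀ hq)).mul_left _
  refine h.congr fun i => ?_
  rw [inv_pow, pow_succ]; field_simp

lemma tsum_geom {q : ℝ} (hq : 1 < q) (a : ℝ) : ∑' i : ℕ, a / q ^ (i + 1) = a / (q - 1) := by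
  have h : ∀ i : ℕ, a / q ^ (i + 1) = (a / q) * q⁻¹ ^ i := fun i => by
    rw [inv_pow, pow_succ]; field_simp
  have h1 : q - 1 ≠ 0 := by linarith
  have h2 : q ≠ 0 := by linarith
  simp_rw [h]
  rw [tsum_mul_left, tsum_geometric_of_lt_one (by positivity) (inv_lt_one_of_one_lt₀ hq)]
  field_simp

lemma summable_piQ {M : ℕ} {q : ℝ} (hq : 1 < q) (x : Digits M) :
    Summable fun i : ℕ => (x i : ℝ) / q ^ (i + 1) :=
  (summable_geom hq M).of_nonneg_of_le (fun i => by positivity) fun i => by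
    gcongr; exact_mod_cast digit_le x i

lemma piQ_nonneg {M : ℕ} {q : ℝ} (hq : 1 < q) (x : Digits M) : 0 ≤ piQ M q x :=
  tsum_nonneg fun i => by positivity

lemma piQ_refl {M : ℕ} {q : ℝ} (hq : 1 < q) (x : Digits M) :
    piQ M q (refl x) = M / (q - 1) - piQ M q x := by
  rw [eq_sub_iff_add_eq, piQ, piQ, ← (summable_piQ hq _).tsum_add (summable_piQ hq _),
    ← tsum_geom hq]
  refine tsum_congr fun i => ?_
  rw [← add_div]
  congr 1
  exact_mod_cast refl_val x i

lemma piQ_le {M : ℕ} {q : ℝ} (hq : 1 < q) (x : Digits M) : piQ M q x ≤ M / (q - 1) := by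
  have := piQ_refl hq x
  have := piQ_nonneg hq (refl x)
  linarith

/-- The contribution of the first `n` digits to the value. -/
noncomputable def preVal {M : ℕ} (q : ℝ) (n : ℕ) (x : Digits M) : ℝ :=
  ∑ i ∈ Finset.range n, (x i : ℝ) / q ^ (i + 1)

lemma preVal_congr {M : ℕ} {q : ℝ} {n : ℕ} {x y : Digits M} (h : ∀ i < n, x i = y i) :
    preVal q n x = preVal q n y :=
  Finset.sum_congr rfl fun i hi => by rw [h i (Finset.mem_range.mp hi)]

lemma preVal_nonneg {M : ℕ} {q : ℝ} (hq : 0 < q) (n : ℕ) (x : Digits M) : 0 ≤ preVal q n x :=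
  Finset.sum_nonneg fun i _ => by positivity

lemma piQ_eq_preVal_add {M : ℕ} {q : ℝ} (hq : 1 < q) (n : ℕ) (x : Digits M) :
    piQ M q x = preVal q n x + piQ M q (shift n x) / q ^ n := by
  have h := (summable_piQ hq x).sum_add_tsum_nat_add n
  rw [piQ, ← h, preVal, piQ, ← tsum_div_const]
  congr 1
  refine tsum_congr fun i => ?_
  simp only [shift]
  rw [div_div, ← pow_add]
  congr 2; ring

lemma piQ_splice {M : ℕ} {q : ℝ} (hq : 1 < q) (n : ℕ) (v x : Digits M) :
    piQ M q (splice n v x) = preVal q n v + piQ M q x / q ^ n := by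
  rw [piQ_eq_preVal_add hq n, shift_splice]
  congr 1
  exact preVal_congr fun i hi => by simp [splice, hi]

lemma piQ_head {M : ℕ} {q : ℝ} (hq : 1 < q) (x : Digits M) :
    piQ M q x = (x 0 + piQ M q (shift 1 x)) / q := by
  rw [piQ_eq_preVal_add hq 1, preVal]
  simp [add_div]

lemma piQ_head_shift {M : ℕ} {q : ℝ} (hq : 1 < q) (n : ℕ) (x : Digits M) :
    q * piQ M q (shift n x) = x n + piQ M q (shift (n + 1) x) := by
  rw [piQ_head hq, shift_shift, add_comm 1 n]
  have : q ≠ 0 := by linarith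
  field_simp
  simp [shift]

lemma piQ_scale {M : ℕ} {q r : ℝ} (hq : 1 < q) (hqr : q ≤ r) (x : Digits M) :
    piQ M r x ≤ q / r * piQ M q x := by
  have hr : 1 < r := hq.trans_le hqr
  rw [piQ, piQ, ← tsum_mul_left]
  refine (summable_piQ hr x).tsum_le_tsum (fun i => ?_) ((summable_piQ hq x).mul_left _)
  have h1 : (q / r) ^ (i + 1) ≤ q / r :=
    pow_le_of_le_one (by positivity) ((div_le_one (by linarith)).mpr hqr) (by omega)
  calc (x i : ℝ) / r ^ (i + 1) = (q / r) ^ (i + 1) * (x i / q ^ (i + 1)) := by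
        rw [div_pow]; field_simp
    _ ≤ _ := by gcongr

lemma piQ_anti {M : ℕ} {q r : ℝ} (hq : 1 < q) (hqr : q ≤ r) (x : Digits M) :
    piQ M r x ≤ piQ M q x :=
  (piQ_scale hq hqr x).trans (mul_le_of_le_one_left (piQ_nonneg hq x)
    ((div_le_one (by linarith)).mpr hqr))

lemma continuousOn_piQ (M : ℕ) :
    ContinuousOn (fun a : ℝ × Digits M => piQ M a.1 a.2) (Set.Ioi 1 ×ˢ Set.univ) := by
  intro a ha
  have ha1 : 1 < a.1 := ha.1
  obtain ⟨r, hr, hra⟩ := exists_between ha1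
  have hc : ContinuousOn (fun a : ℝ × Digits M => piQ M a.1 a.2) (Set.Ioi r ×ˢ Set.univ) := by
    unfold piQ
    refine continuousOn_tsum (u := fun i => (M : ℝ) / r ^ (i + 1)) (fun i => ?_)
      (summable_geom hr M) fun i y hy => ?_
    · refine ContinuousOn.div ?_ (by fun_prop) fun y hy => ?_
      · refine Continuous.continuousOn ?_
        exact (continuous_of_discreteTopology (f := fun a : Fin (M + 1) => ((a : ℕ) : ℝ))).comp
          ((continuous_apply i).comp continuous_snd)
      · have : r < y.1 := hy.1
        have : 0 < y.1 := by linarith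
        positivity
    · have h1 : r < y.1 := hy.1
      have h2 : 0 < y.1 := by linarith
      rw [Real.norm_of_nonneg (by positivity)]
      gcongr
      · exact_mod_cast digit_le _ i
  have hnhds : Set.Ioi r ×ˢ (Set.univ : Set (Digits M)) ∈ nhds a :=
    (isOpen_Ioi.prod isOpen_univ).mem_nhds ⟨hra, trivial⟩
  exact (hc.continuousAt hnhds).continuousWithinAt

lemma continuous_piQ {M : ℕ} {q : ℝ} (hq : 1 < q) : Continuous (piQ M q) :=
  (continuousOn_piQ M).comp_continuous (f := fun x => (q, x)) (by fun_prop) fun _ => ⟨hq, trivial⟩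

lemma continuousOn_piQ_base {M : ℕ} (x : Digits M) :
    ContinuousOn (fun q => piQ M q x) (Set.Ioi 1) :=
  (continuousOn_piQ M).comp (f := fun q => (q, x)) (by fun_prop) fun _ hq => ⟨hq, trivial⟩

lemma exists_digit {M : ℕ} {q v : ℝ} (hq : 1 < q) (hqM : q ≤ M + 1) (h0 : 0 ≤ v)
    (h1 : v ≤ M / (q - 1)) :
    ∃ a : Fin (M + 1), 0 ≤ q * v - (a : ℕ) ∧ q * v - (a : ℕ) ≤ M / (q - 1) := by
  have hq1 : 0 < q - 1 := by linarith
  have hM1 : 1 ≤ (M : ℝ) / (q - 1) := by rw [le_div_iff₀ hq1]; linarith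
  have hqv : 0 ≤ q * v := by positivity
  refine ⟨⟨min M ⌊q * v⌋₊, by omega⟩, ?_, ?_⟩
  · have : ((min M ⌊q * v⌋₊ : ℕ) : ℝ) ≤ ⌊q * v⌋₊ := by exact_mod_cast min_le_right _ _
    have := Nat.floor_le hqv
    simp only
    linarith
  · simp only
    rcases le_total M ⌊q * v⌋₊ with h | h
    · rw [min_eq_left h]
      have : q * v ≤ q * (M / (q - 1)) := by gcongr
      have h2 : q * ((M : ℝ) / (q - 1)) = M + M / (q - 1) := by field_simp; ring
      linarith
    · rw [min_eq_right h]
      have := Nat.lt_floor_add_one (q * v)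
      linarith

lemma exists_expansion {M : ℕ} {q v : ℝ} (hq : 1 < q) (hqM : q ≤ M + 1) (h0 : 0 ≤ v)
    (h1 : v ≤ M / (q - 1)) : ∃ d : Digits M, piQ M q d = v := by
  have hex : ∀ v : ℝ, ∃ a : Fin (M + 1), 0 ≤ v ∧ v ≤ M / (q - 1) →
      0 ≤ q * v - (a : ℕ) ∧ q * v - (a : ℕ) ≤ M / (q - 1) := fun v => by
    by_cases hv : 0 ≤ v ∧ v ≤ M / (q - 1)
    · obtain ⟨a, ha⟩ := exists_digit hq hqM hv.1 hv.2
      exact ⟨a, fun _ => ha⟩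
    · exact ⟨0, fun h => absurd h hv⟩
  choose a ha using hex
  let T : ℝ → ℝ := fun v => q * v - (a v : ℕ)
  have hT : ∀ n, 0 ≤ T^[n] v ∧ T^[n] v ≤ M / (q - 1) := by
    intro n
    induction n with
    | zero => exact ⟨h0, h1⟩
    | succ n ih =>
      rw [Function.iterate_succ_apply']
      exact ha _ ih
  let d : Digits M := fun i => a (T^[i] v)
  have hpart : ∀ n, preVal q n d = v - T^[n] v / q ^ n := by
    intro n
    have hq0 : q ≠ 0 := by linarith
    induction n with
    | zero => simp [preVal]
    | succ n ih =>
      rw [preVal, Finset.sum_range_succ, ← preVal, ih, Function.iterate_succ_apply']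
      simp only [T, d]
      field_simp
      ring
  refine ⟨d, ?_⟩
  have hlim : Filter.Tendsto (fun n => preVal q n d) Filter.atTop (nhds v) := by
    have hz : Filter.Tendsto (fun n : ℕ => T^[n] v / q ^ n) Filter.atTop (nhds 0) := by
      have h2 : Filter.Tendsto (fun n : ℕ => (M / (q - 1)) * q⁻¹ ^ n) Filter.atTop (nhds 0) := by
        simpa using (tendsto_pow_atTop_nhds_zero_of_lt_one (by positivity)
          (inv_lt_one_of_one_lt₀ hq)).const_mul (M / (q - 1))
      refine squeeze_zero (fun n => ?_) (fun n => ?_) h2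
      · have := (hT n).1
        positivity
      · rw [inv_pow, div_eq_mul_inv]
        have := (hT n).2
        gcongr
    simp_rw [hpart]
    simpa using hz.const_sub v
  exact tendsto_nhds_unique (summable_piQ hq d).hasSum.tendsto_sum_nat hlim

/-! ### Unique expansions -/

lemma refl_mem_UqSym {M : ℕ} {q : ℝ} (hq : 1 < q) {d : Digits M} (hd : d ∈ UqSym M q) :
    refl d ∈ UqSym M q := fun e he => by
  have h : refl e = d := hd _ (by rw [piQ_refl hq, he, piQ_refl hq]; ring)
  rw [← h, refl_refl]

lemma shift_lt_one_of_mem_UqSym {M : ℕ} {q : ℝ} (hq : 1 < q) (hqM : q ≤ M + 1) {d : Digits M}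
    (hd : d ∈ UqSym M q) {n : ℕ} (hn : (d n : ℕ) < M) : piQ M q (shift (n + 1) d) < 1 := by
  by_contra hge
  have h1 := piQ_le hq (shift (n + 1) d)
  obtain ⟨f, hf⟩ := exists_expansion (v := piQ M q (shift (n + 1) d) - 1) hq hqM
    (by linarith) (by linarith)
  let v : Digits M := fun i => if i = n then ⟨d n + 1, by omega⟩ else d i
  have hpre : preVal q n v = preVal q n d := preVal_congr fun i hi => by simp [v, hi.ne]
  have heq : piQ M q (splice (n + 1) v f) = piQ M q d := by
    rw [piQ_splice hq, piQ_eq_preVal_add hq (n + 1) d, hf]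
    have h2 : preVal q (n + 1) v = preVal q n v + ((d n : ℝ) + 1) / q ^ (n + 1) := by
      rw [preVal, Finset.sum_range_succ]
      simp [v, preVal]
    have h3 : preVal q (n + 1) d = preVal q n d + (d n : ℝ) / q ^ (n + 1) := by
      rw [preVal, Finset.sum_range_succ, preVal]
    rw [h2, h3, hpre]
    ring
  have h4 := congrArg Fin.val (congrFun (hd _ heq) n)
  simp [splice, v] at h4

lemma refl_shift_lt_one_of_mem_UqSym {M : ℕ} {q : ℝ} (hq : 1 < q) (hqM : q ≤ M + 1)
    {d : Digits M} (hd : d ∈ UqSym M q) {n : ℕ} (hn : 0 < (d n : ℕ)) :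
    piQ M q (refl (shift (n + 1) d)) < 1 := by
  have := refl_val d n
  rw [refl_shift]
  exact shift_lt_one_of_mem_UqSym hq hqM (refl_mem_UqSym hq hd) (by omega)

lemma not_lt_of_piQ_eq {M : ℕ} {q : ℝ} (hq : 1 < q) {d e : Digits M} (he : piQ M q e = piQ M q d)
    {n : ℕ} (hn : ∀ i < n, e i = d i)
    (h : (d n : ℕ) < M → piQ M q (shift (n + 1) d) < 1) : ¬ d n < e n := fun hlt => by
  have hlt' : (d n : ℕ) < e n := hlt
  have hlt'' : (d n : ℝ) + 1 ≤ e n := by exact_mod_cast hlt'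
  have := (e n).isLt
  have h1 := h (by omega)
  have h2 : piQ M q (shift n e) = piQ M q (shift n d) := by
    rw [piQ_eq_preVal_add hq n e, piQ_eq_preVal_add hq n d, preVal_congr hn] at he
    have : q ^ n ≠ 0 := by positivity
    have h3 := add_left_cancel he
    field_simp at h3
    exact h3
  have h3 := piQ_head_shift hq n e
  have h4 := piQ_head_shift hq n d
  have h5 := piQ_nonneg hq (shift (n + 1) e)
  rw [h2] at h3
  linarith

lemma mem_UqSym {M : ℕ} {q : ℝ} (hq : 1 < q) {d : Digits M}
    (h : ∀ n, (d n : ℕ) < M → piQ M q (shift (n + 1) d) < 1)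
    (h' : ∀ n, 0 < (d n : ℕ) → piQ M q (refl (shift (n + 1) d)) < 1) : d ∈ UqSym M q := by
  intro e he
  by_contra hne
  obtain ⟨n, hn, hn'⟩ := exists_agree_of_ne hne
  refine not_lt_of_piQ_eq hq he hn (h n) (lt_of_le_of_ne (not_lt.mp fun hlt => ?_) (Ne.symm hn'))
  refine not_lt_of_piQ_eq hq (d := refl d) (e := refl e) (n := n)
    (by rw [piQ_refl hq, piQ_refl hq, he]) (fun i hi => by simp [refl, hn i hi]) ?_ ?_
  · intro hM
    have := refl_val d n
    exact h' n (by omega)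
  · exact Fin.rev_lt_rev.mpr hlt

lemma not_endsInZero_of_mem_UqSym {M : ℕ} {q : ℝ} (hq : 1 < q) (hqM : q ≤ M + 1) {d : Digits M}
    (hd : d ∈ UqSym M q) (h0 : 0 < piQ M q d) : ¬ EndsInZero d := fun hz => by
  have hzero : ∀ x : Digits M, (∀ i, x i = 0) → piQ M q x = 0 := fun x hx => by simp [piQ, hx]
  have hfind : Nat.find hz ≠ 0 := fun hf => by
    have := Nat.find_spec hz
    rw [hf] at this
    rw [hzero d fun i => this i (by omega)] at h0
    exact lt_irrefl _ h0
  obtain ⟨n, hn⟩ := Nat.exists_eq_succ_of_ne_zero hfind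
  have hspec := Nat.find_spec hz
  have hmin := Nat.find_min hz (m := n) (by omega)
  rw [hn] at hspec
  have hdn : d n ≠ 0 := fun h => hmin fun m hm => by
    rcases hm.eq_or_lt with rfl | hm
    · exact h
    · exact hspec m hm
  have h1 := refl_shift_lt_one_of_mem_UqSym hq hqM hd (n := n) (Fin.pos_iff_ne_zero.mpr hdn)
  rw [piQ_refl hq, hzero (shift (n + 1) d) fun i => hspec _ (by omega), sub_zero,
    div_lt_one (by linarith)] at h1
  linarith

lemma phi_eq {M : ℕ} {q x : ℝ} (hq : 1 < q) (hqM : q ≤ M + 1) (hx : 0 < x) {d : Digits M}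
    (hd : d ∈ UqSym M q) (hdx : piQ M q d = x) : Phi M x q = d := by
  have hqg : IsQuasiGreedy M q x d :=
    ⟨hdx, not_endsInZero_of_mem_UqSym hq hqM hd (hdx ▸ hx), fun e he _ =>
      Or.inl (hd e (he.trans hdx.symm))⟩
  have hex : ∃ d : Digits M, IsQuasiGreedy M q x d := ⟨d, hqg⟩
  rw [Phi, dif_pos hex]
  exact hd _ (hex.choose_spec.1.trans hdx.symm)

lemma mem_UxSym_iff {M : ℕ} {x : ℝ} (hx : 0 < x) {c : Digits M} :
    c ∈ UxSym M x ↔ ∃ q : ℝ, 1 < q ∧ q ≤ M + 1 ∧ c ∈ UqSym M q ∧ piQ M q c = x := by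
  constructor
  · rintro ⟨q, ⟨⟨hq, hqM⟩, d, hd, huniq⟩, rfl⟩
    have hd' : d ∈ UqSym M q := fun e he => huniq e (he.trans hd)
    rw [phi_eq hq hqM hx hd' hd]
    exact ⟨q, hq, hqM, hd', hd⟩
  · rintro ⟨q, hq, hqM, hc, hcx⟩
    exact ⟨q, ⟨⟨hq, hqM⟩, c, hcx, fun e he => hc e (he.trans hcx.symm)⟩, phi_eq hq hqM hx hc hcx⟩

/-- Sequences all of whose tails, and reflected tails, have value at most one in base `q`. -/
def tailSet (M : ℕ) (q : ℝ) : Set (Digits M) :=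
  {x | ∀ k, piQ M q (shift k x) ≤ 1 ∧ piQ M q (refl (shift k x)) ≤ 1}

lemma shift_mem_tailSet {M : ℕ} {q : ℝ} (k : ℕ) {x : Digits M} (hx : x ∈ tailSet M q) :
    shift k x ∈ tailSet M q := fun j => by rw [shift_shift]; exact hx _

lemma refl_mem_tailSet {M : ℕ} {q : ℝ} {x : Digits M} (hx : x ∈ tailSet M q) :
    refl x ∈ tailSet M q := fun j => by
  rw [← refl_shift, refl_refl]; exact (hx j).symm

lemma tailSet_mono {M : ℕ} {q r : ℝ} (hq : 1 < q) (hqr : q ≤ r) : tailSet M q ⊆ tailSet M r :=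
  fun _ hx k => ⟨(piQ_anti hq hqr _).trans (hx k).1, (piQ_anti hq hqr _).trans (hx k).2⟩

lemma isClosed_tailSet {M : ℕ} {q : ℝ} (hq : 1 < q) : IsClosed (tailSet M q) := by
  simp only [tailSet, Set.ofPred_forall]
  refine isClosed_iInter fun k => ?_
  exact (isClosed_le ((continuous_piQ hq).comp (continuous_shift k)) continuous_const).inter
    (isClosed_le ((continuous_piQ hq).comp (continuous_refl.comp (continuous_shift k)))
      continuous_const)

lemma tail_refl_lt_one {M : ℕ} {q : ℝ} (hq : 1 < q) (hqM : q ≤ M + 1) {d : Digits M}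
    (hd : d ∈ UqSym M q) {n : ℕ} (hn : 0 < (d n : ℕ)) {m : ℕ} (hm : n < m) :
    piQ M q (refl (shift m d)) < 1 := by
  induction m, hm using Nat.le_induction with
  | base => exact refl_shift_lt_one_of_mem_UqSym hq hqM hd hn
  | succ m _ ih =>
    rcases Nat.eq_zero_or_pos (d m : ℕ) with h0 | h0
    · have h1 := piQ_head_shift hq m (refl d)
      have h2 := refl_val d m
      have h3 : ((refl d m : ℕ) : ℝ) = M := by exact_mod_cast (by omega : (refl d m : ℕ) = M)
      rw [h3, ← refl_shift, ← refl_shift] at h1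
      nlinarith
    · exact refl_shift_lt_one_of_mem_UqSym hq hqM hd h0

lemma exists_shift_mem_tailSet {M : ℕ} {q : ℝ} (hq : 1 < q) (hqM : q ≤ M + 1) {d : Digits M}
    (hd : d ∈ UqSym M q) {m n : ℕ} (hm : 0 < (d m : ℕ)) (hn : (d n : ℕ) < M) :
    shift (m + n + 1) d ∈ tailSet M q := by
  intro k
  rw [shift_shift]
  have := refl_val d n
  refine ⟨?_, (tail_refl_lt_one hq hqM hd hm (by omega)).le⟩
  have h := tail_refl_lt_one hq hqM (refl_mem_UqSym hq hd) (n := n) (by omega)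
    (m := k + (m + n + 1)) (by omega)
  rw [← refl_shift, refl_refl] at h
  exact h.le

lemma qx_bounds {M : ℕ} (hM : 0 < M) {x : ℝ} (hx : 0 < x) : 1 < qx M x ∧ qx M x ≤ M + 1 := by
  have hM' : (0 : ℝ) < M := by exact_mod_cast hM
  exact ⟨lt_min (by linarith) (by have : 0 < (M : ℝ) / x := by positivity
                                  linarith), min_le_left _ _⟩

lemma le_qx {M : ℕ} {x q : ℝ} (hx : 0 < x) (hq : 1 < q) (hqM : q ≤ M + 1)
    (h : x ≤ M / (q - 1)) : q ≤ qx M x := by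
  refine le_min hqM ?_
  rw [le_div_iff₀ (by linarith)] at h
  have : q - 1 ≤ M / x := by rw [le_div_iff₀ hx]; linarith
  linarith

lemma gdimH_UxSym_le {M : ℕ} {x : ℝ} (hx : 0 < x) :
    gdimH (rho M) (UxSym M x) ≤ gdimH (rho M) (tailSet M (qx M x)) := by
  have hsub : UxSym M x ⊆ {fun _ => Fin.last M} ∪ ⋃ k : ℕ, shift k ⁻¹' tailSet M (qx M x) := by
    intro c hc
    obtain ⟨q, hq, hqM, hcq, rfl⟩ := (mem_UxSym_iff hx).mp hc
    by_cases hlast : ∀ n, c n = Fin.last M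
    · exact Or.inl (funext hlast)
    · push Not at hlast
      obtain ⟨n, hn⟩ := hlast
      have hn' : (c n : ℕ) < M := Fin.lt_last_iff_ne_last.mpr hn
      have hm : ∃ m, 0 < (c m : ℕ) := by
        by_contra hcon
        push Not at hcon
        have : piQ M q c = 0 := by
          simp [piQ, fun i => Nat.le_zero.mp (hcon i)]
        linarith
      obtain ⟨m, hm⟩ := hm
      refine Or.inr (Set.mem_iUnion.mpr ⟨m + n + 1, ?_⟩)
      exact tailSet_mono hq (le_qx hx hq hqM (piQ_le hq c))
        (exists_shift_mem_tailSet hq hqM hcq hm hn')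
  refine (gdimH_mono hsub).trans (gdimH_union_le ?_ (gdimH_iUnion_le fun k =>
    gdimH_shift_preimage_le k _))
  rw [gdimH_countable (Set.countable_singleton _)]
  exact zero_le

/-! ### Lexicographic subshifts -/

/-- Sequences all of whose tails lie lexicographically between `refl β` and `β`. -/
def lexSet {M : ℕ} (β : Digits M) : Set (Digits M) :=
  {x | ∀ k, WordLe (shift k x) β ∧ WordLe (refl β) (shift k x)}

lemma isClosed_wordGe {M : ℕ} (y : Digits M) : IsClosed {x : Digits M | WordLe y x} := by
  simp only [WordLe, Set.ofPred_forall]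
  exact isClosed_iInter fun n => isClosed_le continuous_const (continuous_wordVal n)

lemma isClosed_lexSet {M : ℕ} (β : Digits M) : IsClosed (lexSet β) := by
  simp only [lexSet, Set.ofPred_forall]
  exact isClosed_iInter fun k => ((isClosed_wordLe β).preimage (continuous_shift k)).inter
    ((isClosed_wordGe (refl β)).preimage (continuous_shift k))

lemma shift_mem_lexSet {M : ℕ} {β : Digits M} (k : ℕ) {x : Digits M} (hx : x ∈ lexSet β) :
    shift k x ∈ lexSet β := fun j => by rw [shift_shift]; exact hx _

lemma refl_mem_lexSet {M : ℕ} {β x : Digits M} (hx : x ∈ lexSet β) : refl x ∈ lexSet β :=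
  fun j => by
    rw [← refl_shift]
    exact ⟨by simpa using (hx j).2.refl_anti, (hx j).1.refl_anti⟩

lemma subset_lexSet {M : ℕ} {Z : Set (Digits M)} (hs : ∀ k, ∀ x ∈ Z, shift k x ∈ Z)
    (hr : ∀ x ∈ Z, refl x ∈ Z) {β : Digits M} (hβ : ∀ x ∈ Z, WordLe x β) : Z ⊆ lexSet β :=
  fun x hx k => ⟨hβ _ (hs k x hx), by
    simpa using (hβ _ (hr _ (hs k x hx))).refl_anti⟩

lemma preVal_succ {M : ℕ} (q : ℝ) (n : ℕ) (x : Digits M) :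
    preVal q (n + 1) x = preVal q n x + (x n : ℝ) / q ^ (n + 1) := by
  rw [preVal, Finset.sum_range_succ, preVal]

lemma piQ_le_of_first_lt {M : ℕ} {p : ℝ} (hp : 1 < p) {x β : Digits M} {n : ℕ}
    (hn : ∀ i < n, x i = β i) (hlt : x n < β n) :
    piQ M p x ≤ preVal p (n + 1) β + (piQ M p (shift (n + 1) x) - 1) / p ^ (n + 1) := by
  have h1 : (x n : ℝ) + 1 ≤ β n := by
    have : (x n : ℕ) < β n := hlt
    exact_mod_cast this
  have hp0 : 0 < p ^ (n + 1) := by positivity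
  rw [piQ_eq_preVal_add hp (n + 1) x, preVal_succ, preVal_succ, preVal_congr hn, add_assoc,
    add_assoc, ← add_div, ← add_div]
  exact add_le_add le_rfl (div_le_div_of_nonneg_right (by linarith) hp0.le)

lemma preVal_le_piQ {M : ℕ} {p : ℝ} (hp : 1 < p) (n : ℕ) (x : Digits M) :
    preVal p n x ≤ piQ M p x := by
  rw [piQ_eq_preVal_add hp n x]
  have := piQ_nonneg hp (shift n x)
  have : 0 < p ^ n := by positivity
  have : 0 ≤ piQ M p (shift n x) / p ^ n := by positivity
  linarith

lemma piQ_le_one_of_wordLe {M : ℕ} {p : ℝ} (hp : 1 < p) {x β : Digits M} (hβ : piQ M p β ≤ 1)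
    (h : ∀ k, WordLe (shift k x) β) (k : ℕ) : piQ M p (shift k x) ≤ 1 := by
  have hbdd : BddAbove (Set.range fun k => piQ M p (shift k x)) :=
    ⟨_, by rintro _ ⟨k, rfl⟩; exact piQ_le hp _⟩
  set S := ⨆ k, piQ M p (shift k x) with hS
  have hle : ∀ k, piQ M p (shift k x) ≤ S := fun k => le_ciSup hbdd k
  suffices S ≤ 1 from (hle k).trans this
  by_contra hS1
  push Not at hS1
  have key : ∀ k, piQ M p (shift k x) ≤ 1 + (S - 1) / p := by
    intro k
    have hpos : 0 ≤ (S - 1) / p := div_nonneg (by linarith) (by linarith)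
    by_cases heq : shift k x = β
    · rw [heq]; linarith
    · obtain ⟨n, hn, hlt⟩ := (h k).exists_lt heq
      refine (piQ_le_of_first_lt hp hn hlt).trans
        (add_le_add ((preVal_le_piQ hp _ _).trans hβ) ?_)
      rw [shift_shift]
      calc (piQ M p (shift (n + 1 + k) x) - 1) / p ^ (n + 1) ≤ (S - 1) / p ^ (n + 1) := by
            gcongr; exact hle _
        _ ≤ (S - 1) / p := by
            have : 0 ≤ S - 1 := by linarith
            gcongr
            exact le_self_pow₀ hp.le (by omega)
  have h1 : S ≤ 1 + (S - 1) / p := ciSup_le key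
  have h2 : (S - 1) / p < S - 1 := div_lt_self (by linarith) hp
  linarith

lemma lexSet_subset_tailSet {M : ℕ} {p : ℝ} (hp : 1 < p) {β : Digits M} (hβ : piQ M p β ≤ 1) :
    lexSet β ⊆ tailSet M p := fun _ hx k =>
  ⟨piQ_le_one_of_wordLe hp hβ (fun j => (hx j).1) k,
    piQ_le_one_of_wordLe hp hβ (fun j => (refl_mem_lexSet hx j).1) k⟩

lemma exists_tailSet_eq_lexSet {M : ℕ} {q : ℝ} (hq : 1 < q) (hne : (tailSet M q).Nonempty) :
    ∃ α ∈ lexSet α, tailSet M q = lexSet α ∧ piQ M q α ≤ 1 := by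
  obtain ⟨α, hα, hmax⟩ := exists_lexmax (isClosed_tailSet hq) hne
  have hsub : tailSet M q ⊆ lexSet α :=
    subset_lexSet (fun k _ hx => shift_mem_tailSet k hx) (fun _ hx => refl_mem_tailSet hx) hmax
  have h1 : piQ M q α ≤ 1 := (hα 0).1
  exact ⟨α, hsub hα, hsub.antisymm (lexSet_subset_tailSet hq h1), h1⟩

lemma piQ_pos_of_ne_zero {M : ℕ} {q : ℝ} (hq : 1 < q) {x : Digits M} {i : ℕ} (h : x i ≠ 0) :
    0 < piQ M q x := by
  refine (summable_piQ hq x).tsum_pos (fun i => by positivity) i ?_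
  have : 0 < (x i : ℕ) := Fin.pos_iff_ne_zero.mpr h
  positivity

lemma exists_base_lt_of_mem_lexSet {M : ℕ} (hM : 0 < M) {q : ℝ} (hq : 1 < q) {α β : Digits M}
    (hα : α ∈ lexSet α) (hα1 : piQ M q α ≤ 1) (hβ : β ∈ lexSet α) (hne : β ≠ α) :
    ∃ p, 1 < p ∧ p < q ∧ lexSet β ⊆ tailSet M p := by
  obtain ⟨n, hn, hlt⟩ := (hβ 0).1.exists_lt hne
  have h1 := piQ_le_of_first_lt hq hn hlt
  have h2 := piQ_le_one_of_wordLe hq hα1 (fun j => (hβ j).1) (n + 1)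
  have hpos : 0 < piQ M q (shift (n + 1) α) := by
    by_contra hnp
    have hz : ∀ i, shift (n + 1) α i = 0 := fun i => by
      by_contra hi
      exact hnp (piQ_pos_of_ne_zero hq hi)
    have h4 : WordLe (refl α) (shift (n + 1) α) := (hα (n + 1)).2
    have h5 : refl α = shift (n + 1) α := by
      by_contra hne'
      obtain ⟨k, -, hk⟩ := h4.exists_lt hne'
      rw [hz k] at hk
      exact absurd hk (Fin.not_lt_zero _)
    have h6 := congrFun h5 (n + 1)
    rw [hz] at h6
    have h7 := refl_val α (n + 1)
    have h8 := hz 0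
    simp only [shift, zero_add] at h8
    rw [h6, h8] at h7
    simp at h7
    omega
  have h3 : piQ M q β < 1 := by
    have hp0 : 0 < q ^ (n + 1) := by positivity
    have h4 := piQ_eq_preVal_add hq (n + 1) α
    have h5 : (piQ M q (shift (n + 1) β) - 1) / q ^ (n + 1) ≤ 0 :=
      div_nonpos_of_nonpos_of_nonneg (by linarith) hp0.le
    have h6 : 0 < piQ M q (shift (n + 1) α) / q ^ (n + 1) := by positivity
    have h7 : piQ M q β ≤ preVal q (n + 1) α + (piQ M q (shift (n + 1) β) - 1) / q ^ (n + 1) := h1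
    linarith
  have hc : ContinuousAt (fun q => piQ M q β) q :=
    (continuousOn_piQ_base β).continuousAt (Ioi_mem_nhds hq)
  have hev : ∀ᶠ p in nhdsWithin q (Set.Iio q), piQ M p β < 1 ∧ 1 < p ∧ p < q := by
    refine Filter.Eventually.and ?_ (Filter.Eventually.and ?_ self_mem_nhdsWithin)
    · exact (hc.eventually (gt_mem_nhds h3)).filter_mono nhdsWithin_le_nhds
    · exact (Ioi_mem_nhds hq : Set.Ioi 1 ∈ nhds q) |> fun h => nhdsWithin_le_nhds h
  obtain ⟨p, hp, hp1, hpq⟩ := hev.exists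
  exact ⟨p, hp1, hpq, lexSet_subset_tailSet hp1 hp.le⟩

/-! ### Counting words of a lexicographic subshift -/

lemma wordLe_of_wordVal_lt {M : ℕ} {n : ℕ} {x y : Digits M} (h : wordVal n x < wordVal n y) :
    WordLe x y := by
  by_contra hc
  obtain ⟨k, hk, hlt⟩ := exists_lt_of_not_wordLe hc
  have := wordLe_of_lt (fun i hi => (hk i hi).symm) hlt n
  omega

lemma wordVal_one_add {M : ℕ} (n : ℕ) (x : Digits M) :
    wordVal (n + 1) x = x 0 * (M + 1) ^ n + wordVal n (shift 1 x) := by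
  rw [add_comm n 1, wordVal_add]
  simp [wordVal_succ]

/-- The set of words of length `n` that start elements of `X`, as a finset of integers. -/
noncomputable def wordFinset {M : ℕ} (X : Set (Digits M)) (n : ℕ) : Finset ℕ :=
  (finite_image_wordVal n X).toFinset

lemma mem_wordFinset {M : ℕ} {X : Set (Digits M)} {n w : ℕ} :
    w ∈ wordFinset X n ↔ ∃ x ∈ X, wordVal n x = w := by simp [wordFinset]

lemma card_wordFinset {M : ℕ} (X : Set (Digits M)) (n : ℕ) :
    (wordFinset X n).card = numWords X n := (Set.ncard_eq_toFinset_card _ _).symm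

/-- The digit `b` followed by the sequence `x`. -/
def cons {M : ℕ} (b : Fin (M + 1)) (x : Digits M) : Digits M := splice 1 (fun _ => b) x

@[simp] lemma shift_cons {M : ℕ} (b : Fin (M + 1)) (x : Digits M) : shift 1 (cons b x) = x :=
  shift_splice _ _ _

lemma mem_lexSet_of_shift {M : ℕ} {β x : Digits M} (h : shift 1 x ∈ lexSet β)
    (h1 : WordLe x β) (h2 : WordLe (refl β) x) : x ∈ lexSet β := fun k => by
  rcases k with _ | k
  · exact ⟨h1, h2⟩
  · have := h k
    rwa [shift_shift] at this

lemma wordFinset_succ {M : ℕ} {β : Digits M} (hβ : β ∈ lexSet β) (n : ℕ) :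
    wordFinset (lexSet β) (n + 1) =
      ((Finset.range (M + 1) ×ˢ wordFinset (lexSet β) n).filter fun p =>
        wordVal (n + 1) (refl β) ≤ p.1 * (M + 1) ^ n + p.2 ∧
          p.1 * (M + 1) ^ n + p.2 ≤ wordVal (n + 1) β).image
        fun p => p.1 * (M + 1) ^ n + p.2 := by
  ext u
  simp only [mem_wordFinset, Finset.mem_image, Finset.mem_filter, Finset.mem_product,
    Finset.mem_range, Prod.exists]
  constructor
  · rintro ⟨x, hx, rfl⟩
    refine ⟨x 0, wordVal n (shift 1 x), ⟨⟨(x 0).isLt, shift 1 x, shift_mem_lexSet 1 hx, rfl⟩, ?_⟩,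
      (wordVal_one_add n x).symm⟩
    rw [← wordVal_one_add]
    exact ⟨(hx 0).2 _, (hx 0).1 _⟩
  · rintro ⟨b, _, ⟨⟨hb, x, hx, rfl⟩, h1, h2⟩, rfl⟩
    have hval : wordVal (n + 1) (cons ⟨b, hb⟩ x) = b * (M + 1) ^ n + wordVal n x := by
      rw [wordVal_one_add, shift_cons]; rfl
    rcases h1.eq_or_lt with h1 | h1
    · exact ⟨refl β, refl_mem_lexSet hβ, h1⟩
    rcases h2.eq_or_lt with h2 | h2
    · exact ⟨β, hβ, h2.symm⟩
    rw [← hval] at h1 h2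
    exact ⟨cons ⟨b, hb⟩ x, mem_lexSet_of_shift (by simpa using hx) (wordLe_of_wordVal_lt h2)
      (wordLe_of_wordVal_lt h1), hval⟩

lemma refl_mem_wordFinset {M : ℕ} {β : Digits M} {n w : ℕ} (hw : w ∈ wordFinset (lexSet β) n) :
    (M + 1) ^ n - 1 - w ∈ wordFinset (lexSet β) n := by
  rw [mem_wordFinset] at hw ⊢
  obtain ⟨x, hx, rfl⟩ := hw
  refine ⟨refl x, refl_mem_lexSet hx, ?_⟩
  have := wordVal_refl n x
  omega

lemma lt_of_mem_wordFinset {M : ℕ} {X : Set (Digits M)} {n w : ℕ} (hw : w ∈ wordFinset X n) :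
    w < (M + 1) ^ n := by
  obtain ⟨x, -, rfl⟩ := mem_wordFinset.mp hw
  exact wordVal_lt n x

/-- Twice the number of admissible words up to the prefix of `p`, minus the number of all words. -/
noncomputable def signedCount {M : ℕ} (β : Digits M) (n : ℕ) (p : Digits M) : ℤ :=
  2 * ((wordFinset (lexSet β) n).filter fun w => w ≤ wordVal n p).card - numWords (lexSet β) n

lemma pair_val_injOn {B : ℕ} : Set.InjOn (fun p : ℕ × ℕ => p.1 * B + p.2) {p | p.2 < B} := by
  rintro ⟨a, b⟩ hb ⟨c, d⟩ hd h
  simp only [Set.mem_ofPred_eq] at hb hd h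
  have hB : 0 < B := by omega
  have h1 : a = c := by
    have := congrArg (· / B) h
    simpa [add_comm, Nat.add_mul_div_right _ _ hB, Nat.div_eq_of_lt hb,
      Nat.div_eq_of_lt hd] using this
  subst h1
  simp at h
  simp [h]

lemma signedCount_succ {M : ℕ} {β : Digits M} (hβ : β ∈ lexSet β) (n : ℕ) {p : Digits M}
    (hp : p ∈ lexSet β) :
    signedCount β (n + 1) p =
      (2 * (p 0 : ℤ) - M) * numWords (lexSet β) n + signedCount β n (shift 1 p) := by
  set L := wordFinset (lexSet β) n with hL
  set B := (M + 1) ^ n with hB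
  set P := Finset.range (M + 1) ×ˢ L with hP
  set g : ℕ × ℕ → ℕ := fun p => p.1 * B + p.2 with hg
  set lo := wordVal (n + 1) (refl β)
  set hi := wordVal (n + 1) β
  set v := wordVal (n + 1) p with hv
  have hlov : lo ≤ v := (hp 0).2 _
  have hvhi : v ≤ hi := (hp 0).1 _
  have hlohi : lo + hi + 1 = (M + 1) * B := by
    have := wordVal_refl (n + 1) β
    rw [pow_succ] at this
    rw [hB]
    linarith
  have hLB : ∀ w ∈ L, w < B := fun w hw => lt_of_mem_wordFinset hw
  have hinj : Set.InjOn g P := pair_val_injOn.mono fun p hp => by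
    rw [Finset.mem_coe, hP, Finset.mem_product] at hp
    exact hLB _ hp.2
  have hPcard : P.card = (M + 1) * L.card := by rw [hP, Finset.card_product, Finset.card_range]
  have hrefl : (P.filter fun p => g p < lo).card = (P.filter fun p => hi < g p).card := by
    have hmaps : ∀ p ∈ P, (M - p.1, B - 1 - p.2) ∈ P ∧
        g (M - p.1, B - 1 - p.2) + g p + 1 = (M + 1) * B ∧
        (M - (M - p.1), B - 1 - (B - 1 - p.2)) = p := by
      rintro ⟨a, w⟩ hp
      rw [hP, Finset.mem_product, Finset.mem_range] at hp
      have h1 := hLB _ hp.2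
      have ha := hp.1
      simp only at h1 ha
      refine ⟨?_, ?_, ?_⟩
      · rw [hP, Finset.mem_product, Finset.mem_range]
        exact ⟨by simp only; omega, refl_mem_wordFinset hp.2⟩
      · simp only [hg]
        obtain ⟨c, hc⟩ : ∃ c, M = a + c := ⟨M - a, by omega⟩
        obtain ⟨d, hd⟩ : ∃ d, B = w + 1 + d := ⟨B - w - 1, by omega⟩
        rw [show M - a = c by omega, show B - 1 - w = d by omega, hc, hd]
        ring
      · simp only [Prod.mk.injEq]; omega
    refine Finset.card_bij' (fun p _ => (M - p.1, B - 1 - p.2)) (fun p _ => (M - p.1, B - 1 - p.2))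
      ?_ ?_ ?_ ?_
    · intro p hp
      rw [Finset.mem_filter] at hp ⊢
      have := hmaps p hp.1
      exact ⟨this.1, by omega⟩
    · intro p hp
      rw [Finset.mem_filter] at hp ⊢
      have := hmaps p hp.1
      exact ⟨this.1, by omega⟩
    · intro p hp
      exact (hmaps p (Finset.mem_filter.mp hp).1).2.2
    · intro p hp
      exact (hmaps p (Finset.mem_filter.mp hp).1).2.2
  have hsucc : wordFinset (lexSet β) (n + 1) =
      (P.filter fun p => lo ≤ g p ∧ g p ≤ hi).image g := wordFinset_succ hβ n
  have hN : numWords (lexSet β) (n + 1) + 2 * (P.filter fun p => g p < lo).card = P.card := by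
    rw [← card_wordFinset, hsucc, Finset.card_image_of_injOn (hinj.mono
      (Finset.coe_subset.mpr (Finset.filter_subset _ _))), two_mul]
    nth_rewrite 2 [hrefl]
    rw [← Finset.card_filter_add_card_filter_not (s := P) (fun p => g p < lo),
      ← Finset.card_filter_add_card_filter_not (s := P.filter fun p => ¬ g p < lo)
        (fun p => g p ≤ hi),
      Finset.filter_filter, Finset.filter_filter]
    have e1 : (P.filter fun p => ¬ g p < lo ∧ g p ≤ hi) = P.filter fun p => lo ≤ g p ∧ g p ≤ hi :=
      Finset.filter_congr fun p _ => by rw [not_lt]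
    have e2 : (P.filter fun p => ¬ g p < lo ∧ ¬ g p ≤ hi) = P.filter fun p => hi < g p :=
      Finset.filter_congr fun p _ => by omega
    rw [e1, e2]
    omega
  have hle : ((wordFinset (lexSet β) (n + 1)).filter fun w => w ≤ v).card +
      (P.filter fun p => g p < lo).card = (P.filter fun p => g p ≤ v).card := by
    rw [hsucc, Finset.filter_image, Finset.card_image_of_injOn (hinj.mono (Finset.coe_subset.mpr
      ((Finset.filter_subset _ _).trans (Finset.filter_subset _ _)))), Finset.filter_filter,
      ← Finset.card_filter_add_card_filter_not (s := P.filter fun p => g p ≤ v) (fun p => lo ≤ g p),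
      Finset.filter_filter, Finset.filter_filter]
    have e1 : (P.filter fun p => (lo ≤ g p ∧ g p ≤ hi) ∧ g p ≤ v) =
        P.filter fun p => g p ≤ v ∧ lo ≤ g p := Finset.filter_congr fun p _ => by omega
    have e2 : (P.filter fun p => g p < lo) = P.filter fun p => g p ≤ v ∧ ¬ lo ≤ g p :=
      Finset.filter_congr fun p _ => by omega
    rw [e1, e2]
  have hcount : (P.filter fun p => g p ≤ v).card =
      p 0 * L.card + (L.filter fun w => w ≤ wordVal n (shift 1 p)).card := by
    have hvv : v = p 0 * B + wordVal n (shift 1 p) := wordVal_one_add n p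
    have hv'B : wordVal n (shift 1 p) < B := wordVal_lt n _
    have e : (P.filter fun p => g p ≤ v) = (Finset.range (p 0)) ×ˢ L ∪
        {(p 0 : ℕ)} ×ˢ (L.filter fun w => w ≤ wordVal n (shift 1 p)) := by
      ext ⟨a, w⟩
      have hp0 := (p 0).isLt
      simp only [hP, hg, Finset.mem_filter, Finset.mem_product, Finset.mem_range,
        Finset.mem_union, Finset.mem_singleton, hvv]
      constructor
      · rintro ⟨⟨ha, hw⟩, hle⟩
        rcases lt_trichotomy a (p 0) with h | h | h
        · exact Or.inl ⟨h, hw⟩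
        · exact Or.inr ⟨h, hw, by rw [h] at hle; omega⟩
        · exfalso
          have : ((p 0 : ℕ) + 1) * B ≤ a * B := Nat.mul_le_mul_right _ h
          rw [add_mul] at this
          omega
      · rintro (⟨ha, hw⟩ | ⟨rfl, hw, hle⟩)
        · refine ⟨⟨by omega, hw⟩, ?_⟩
          have : (a + 1) * B ≤ p 0 * B := Nat.mul_le_mul_right _ ha
          rw [add_mul] at this
          have := hLB w hw
          omega
        · exact ⟨⟨hp0, hw⟩, by omega⟩
    rw [e, Finset.card_union_of_disjoint, Finset.card_product, Finset.card_product,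
      Finset.card_range, Finset.card_singleton, one_mul]
    rw [Finset.disjoint_left]
    rintro ⟨a, w⟩ h1 h2
    simp only [Finset.mem_product, Finset.mem_range, Finset.mem_singleton] at h1 h2
    omega
  have hLc : L.card = numWords (lexSet β) n := card_wordFinset _ _
  simp only [signedCount, ← hv, ← hL]
  rw [← hLc]
  rw [hcount] at hle
  rw [hPcard] at hN
  have hN' := congrArg (Nat.cast (R := ℤ)) hN
  have hle' := congrArg (Nat.cast (R := ℤ)) hle
  push_cast at hN' hle'
  linear_combination 2 * hle' - hN'

lemma signedCount_eq_sum {M : ℕ} {β : Digits M} (hβ : β ∈ lexSet β) (n : ℕ) {p : Digits M}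
    (hp : p ∈ lexSet β) :
    signedCount β n p =
      1 + ∑ j ∈ Finset.range n, (2 * (p j : ℤ) - M) * numWords (lexSet β) (n - 1 - j) := by
  induction n generalizing p with
  | zero =>
    have h : wordFinset (lexSet β) 0 = {0} := by
      ext w
      rw [mem_wordFinset]
      simp only [wordVal_zero, Finset.mem_singleton]
      exact ⟨fun ⟨_, _, h⟩ => h.symm, fun h => ⟨β, hβ, h.symm⟩⟩
    simp [signedCount, ← card_wordFinset, h, Finset.filter_singleton]
  | succ n ih =>
    rw [signedCount_succ hβ n hp, ih (shift_mem_lexSet 1 hp), Finset.sum_range_succ']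
    have : ∀ j ∈ Finset.range n, (2 * (shift 1 p j : ℤ) - M) * numWords (lexSet β) (n - 1 - j) =
        (2 * (p (j + 1) : ℤ) - M) * numWords (lexSet β) (n + 1 - 1 - (j + 1)) := fun j _ => by
      rw [show n + 1 - 1 - (j + 1) = n - 1 - j by omega]; rfl
    rw [Finset.sum_congr rfl this]
    simp
    ring

lemma numWords_eq_sum {M : ℕ} {β : Digits M} (hβ : β ∈ lexSet β) (n : ℕ) :
    (numWords (lexSet β) n : ℤ) =
      1 + ∑ j ∈ Finset.range n, (2 * (β j : ℤ) - M) * numWords (lexSet β) (n - 1 - j) := by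
  rw [← signedCount_eq_sum hβ n hβ, signedCount, Finset.filter_true_of_mem, card_wordFinset]
  · ring
  · intro w hw
    obtain ⟨x, hx, rfl⟩ := mem_wordFinset.mp hw
    exact (hx 0).1 n

lemma numWords_eq_of_agree {M : ℕ} {β γ : Digits M} (hβ : β ∈ lexSet β) (hγ : γ ∈ lexSet γ)
    {m : ℕ} (h : ∀ i < m, β i = γ i) {n : ℕ} (hn : n ≤ m) :
    numWords (lexSet β) n = numWords (lexSet γ) n := by
  induction n using Nat.strong_induction_on with
  | _ n ih =>
  zify
  rw [numWords_eq_sum hβ, numWords_eq_sum hγ]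
  congr 1
  refine Finset.sum_congr rfl fun j hj => ?_
  have hj := Finset.mem_range.mp hj
  rw [h j (by omega), ih (n - 1 - j) (by omega) (by omega)]

/-! ### Approximating a lexicographic subshift from inside -/

/-- A prefix of length `m` none of whose proper suffixes is the reflection of a prefix. -/
def GoodPrefix {M : ℕ} (α : Digits M) (m : ℕ) : Prop :=
  ∀ k, 1 ≤ k → k < m → ∃ i, i + k < m ∧ shift k α i ≠ refl α i

lemma exists_goodPrefix {M : ℕ} {α : Digits M} (hα : α ∈ lexSet α)
    (hgap : ∀ k, 1 ≤ k → shift k α ≠ refl α) (m₀ : ℕ) : ∃ m, m₀ < m ∧ GoodPrefix α m := by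
  have hex : ∀ k, ∃ l, 1 ≤ k → (∀ i < l, refl α i = shift k α i) ∧ refl α l < shift k α l := by
    intro k
    by_cases hk : 1 ≤ k
    · obtain ⟨l, hl⟩ := (hα k).2.exists_lt (hgap k hk).symm
      exact ⟨l, fun _ => hl⟩
    · exact ⟨0, fun h => absurd h hk⟩
  choose l hl using hex
  have step : ∀ k j, 1 ≤ k → 1 ≤ j → j ≤ l k → l (k + j) + j ≤ l k := by
    intro k j hk hj hjl
    by_contra hlt
    push Not at hlt
    obtain ⟨h1, h2⟩ := hl k hk
    obtain ⟨h3, -⟩ := hl (k + j) (by omega)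
    have heq : ∀ i < l k - j, α i = shift j α i := by
      intro i hi
      have e1 := h1 (i + j) (by omega)
      have e2 := h3 i (by omega)
      have e3 : shift k α (i + j) = shift (k + j) α i := by simp only [shift]; congr 1; omega
      rw [← e3, ← e1] at e2
      exact Fin.rev_injective e2
    have e2 := h3 (l k - j) (by omega)
    have e3 : shift k α (l k) = shift (k + j) α (l k - j) := by simp only [shift]; congr 1; omega
    rw [e3, ← e2] at h2
    have h5 : α (l k - j) < α (l k) := Fin.rev_lt_rev.mp h2
    have h6 : α (l k) = shift j α (l k - j) := by simp only [shift]; congr 1; omega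
    rw [h6] at h5
    have h7 := wordVal_lt_of_lt (m := l k - j + 1) heq h5 (Nat.lt_add_one _)
    have h8 := (hα j).1 (l k - j + 1)
    omega
  obtain ⟨K, hK, hmax⟩ := Finset.exists_max_image (Finset.Icc 1 (m₀ + 1)) (fun k => k + l k)
    ⟨1, by simp⟩
  rw [Finset.mem_Icc] at hK
  have hmax' : ∀ k, 1 ≤ k → k ≤ m₀ + 1 → k + l k ≤ K + l K := fun k h1 h2 =>
    hmax k (Finset.mem_Icc.mpr ⟨h1, h2⟩)
  refine ⟨K + l K + 1, by have := hmax' (m₀ + 1) (by omega) le_rfl; omega, fun k hk hkm => ?_⟩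
  have hkl : k + l k ≤ K + l K := by
    rcases le_or_gt k (m₀ + 1) with h | h
    · exact hmax' k hk h
    · have := step K (k - K) hK.1 (by omega) (by omega)
      rw [Nat.add_sub_cancel' (by omega)] at this
      omega
  exact ⟨l k, by omega, (hl k hk).2.ne'⟩

/-- The periodic sequence whose period is the prefix of length `m` with last digit lowered by 1. -/
def lowerPeriodic {M : ℕ} (α : Digits M) (m : ℕ) : Digits M := fun i =>
  if i % m = m - 1 then ⟨α (m - 1) - 1, by have := (α (m - 1)).isLt; omega⟩ else α (i % m)

lemma lowerPeriodic_of_lt {M : ℕ} (α : Digits M) {m i : ℕ} (hi : i < m - 1) :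
    lowerPeriodic α m i = α i := by
  have : i % m = i := Nat.mod_eq_of_lt (by omega)
  rw [lowerPeriodic, if_neg (by omega), this]

lemma lowerPeriodic_last {M : ℕ} (α : Digits M) {m : ℕ} (hm : 1 ≤ m) :
    (lowerPeriodic α m (m - 1) : ℕ) = α (m - 1) - 1 := by
  rw [lowerPeriodic, if_pos (Nat.mod_eq_of_lt (by omega))]

lemma shift_lowerPeriodic {M : ℕ} (α : Digits M) (m k : ℕ) :
    shift k (lowerPeriodic α m) = shift (k % m) (lowerPeriodic α m) := by
  funext i
  simp only [shift, lowerPeriodic, Nat.add_mod_mod]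

section

variable {M : ℕ} {α : Digits M} {m : ℕ}

lemma last_pos_of_goodPrefix (hα : α ∈ lexSet α) (hm : 2 ≤ m) (hg : GoodPrefix α m) :
    0 < (α (m - 1) : ℕ) := by
  obtain ⟨i, hi, hne⟩ := hg (m - 1) (by omega) (by omega)
  obtain rfl : i = 0 := by omega
  have h := (hα (m - 1)).2.head_le
  have h1 : refl α 0 < shift (m - 1) α 0 := lt_of_le_of_ne h (Ne.symm hne)
  simp only [shift, zero_add] at h1
  have h2 : (refl α 0 : ℕ) < α (m - 1) := h1
  omega

lemma wordVal_shift_lowerPeriodic (hpos : 0 < (α (m - 1) : ℕ)) {k : ℕ} (hk : k < m) :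
    wordVal (m - k) (shift k (lowerPeriodic α m)) + 1 = wordVal (m - k) (shift k α) := by
  obtain ⟨n, hn⟩ : ∃ n, m - k = n + 1 := ⟨m - k - 1, by omega⟩
  rw [hn, wordVal_succ, wordVal_succ]
  have h1 : wordVal n (shift k (lowerPeriodic α m)) = wordVal n (shift k α) :=
    wordVal_congr fun i hi => lowerPeriodic_of_lt α (by omega)
  have h2 : (shift k (lowerPeriodic α m) n : ℕ) + 1 = shift k α n := by
    have e : n + k = m - 1 := by omega
    simp only [shift, e]
    rw [lowerPeriodic_last α (by omega)]
    omega
  rw [h1, ← h2]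
  ring

lemma wordVal_lowerPeriodic_of_lt {n : ℕ} (hn : n < m) :
    wordVal n (lowerPeriodic α m) = wordVal n α :=
  wordVal_congr fun _ hi => lowerPeriodic_of_lt α (by omega)

lemma wordLe_shift_lowerPeriodic (hα : α ∈ lexSet α) (hpos : 0 < (α (m - 1) : ℕ)) (hm : 2 ≤ m)
    (k : ℕ) : WordLe (shift k (lowerPeriodic α m)) (lowerPeriodic α m) := by
  rw [shift_lowerPeriodic]
  have hk := Nat.mod_lt k (show 0 < m by omega)
  set j := k % m
  rcases Nat.eq_zero_or_pos j with h | h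
  · rw [h, shift_zero]; exact wordLe_refl _
  · apply wordLe_of_wordVal_lt (n := m - j)
    have h1 := wordVal_shift_lowerPeriodic hpos hk
    rw [wordVal_lowerPeriodic_of_lt (by omega)]
    have := (hα j).1 (m - j)
    omega

lemma refl_wordLe_shift_lowerPeriodic (hα : α ∈ lexSet α) (h0 : refl α 0 < α 0)
    (hg : GoodPrefix α m) (hm : 2 ≤ m) (k : ℕ) :
    WordLe (refl (lowerPeriodic α m)) (shift k (lowerPeriodic α m)) := by
  have hpos := last_pos_of_goodPrefix hα hm hg
  intro N
  induction N using Nat.strong_induction_on generalizing k with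
  | _ N ih =>
  rw [shift_lowerPeriodic]
  have hk := Nat.mod_lt k (show 0 < m by omega)
  set j := k % m
  set β := lowerPeriodic α m with hβ
  rcases Nat.eq_zero_or_pos j with h | h
  · rw [h, shift_zero]
    have e : β 0 = α 0 := lowerPeriodic_of_lt α (by omega)
    refine wordLe_of_lt (n := 0) (by simp) ?_ N
    simpa [refl, e] using h0
  · have hL : wordVal (m - j) (refl β) ≤ wordVal (m - j) (shift j β) := by
      have h1 := wordVal_shift_lowerPeriodic hpos hk
      have h2 := (hα j).2 (m - j)
      have h3 : wordVal (m - j) (refl β) = wordVal (m - j) (refl α) :=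
        wordVal_congr fun i hi => congrArg Fin.rev (lowerPeriodic_of_lt α (by omega))
      have h4 : wordVal (m - j) (refl α) ≠ wordVal (m - j) (shift j α) := fun heq => by
        obtain ⟨i, hi, hne⟩ := hg j h hk
        exact hne (wordVal_eq_iff.mp heq i (by omega)).symm
      have h5 : wordVal (m - j) (shift j β) + 1 = wordVal (m - j) (shift j α) := h1
      have h6 := lt_of_le_of_ne h2 h4
      rw [← h3, ← h5] at h6
      exact Nat.lt_succ_iff.mp h6
    rcases le_or_gt N (m - j) with hN | hN
    · exact wordVal_le_of_le hN hL
    · obtain ⟨n, rfl⟩ := Nat.exists_eq_add_of_le hN.le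
      rw [wordVal_add, wordVal_add, shift_shift, Nat.sub_add_cancel hk.le]
      have e : shift m β = β := by
        rw [hβ, shift_lowerPeriodic, Nat.mod_self, shift_zero]
      rw [e, ← refl_shift]
      have h1 := ih n (by omega) (m - j)
      have h2 := wordVal_refl n β
      have h3 := wordVal_refl n (shift (m - j) β)
      exact add_le_add (Nat.mul_le_mul_right _ hL) (by omega)

lemma lowerPeriodic_mem_lexSet_self (hα : α ∈ lexSet α) (h0 : refl α 0 < α 0)
    (hg : GoodPrefix α m) (hm : 2 ≤ m) : lowerPeriodic α m ∈ lexSet (lowerPeriodic α m) :=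
  fun k => ⟨wordLe_shift_lowerPeriodic hα (last_pos_of_goodPrefix hα hm hg) hm k,
    refl_wordLe_shift_lowerPeriodic hα h0 hg hm k⟩

lemma wordVal_lowerPeriodic_lt (hα : α ∈ lexSet α) (hg : GoodPrefix α m) (hm : 2 ≤ m) :
    wordVal m (lowerPeriodic α m) < wordVal m α := by
  have := wordVal_shift_lowerPeriodic (last_pos_of_goodPrefix hα hm hg) (show 0 < m by omega)
  simp only [tsub_zero, shift_zero] at this
  omega

lemma lexSet_subset_of_wordLe {β : Digits M} (h : WordLe β α) : lexSet β ⊆ lexSet α :=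
  fun _ hx k => ⟨(hx k).1.trans h, h.refl_anti.trans (hx k).2⟩

lemma lowerPeriodic_mem_lexSet (hα : α ∈ lexSet α) (h0 : refl α 0 < α 0)
    (hg : GoodPrefix α m) (hm : 2 ≤ m) : lowerPeriodic α m ∈ lexSet α :=
  lexSet_subset_of_wordLe (wordLe_of_wordVal_lt (wordVal_lowerPeriodic_lt hα hg hm))
    (lowerPeriodic_mem_lexSet_self hα h0 hg hm)

lemma exists_lexSet_of_shift_eq_refl (hα : α ∈ lexSet α) {k : ℕ}
    (hk : shift k α = refl α) {l : ℝ≥0∞} (hl : l < gdimH (rho M) (lexSet α)) :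
    ∃ β ∈ lexSet α, β ≠ α ∧ l < gdimH (rho M) (lexSet β) := by
  let Z : Set (Digits M) := lexSet α ∩
    {x | ∀ j, wordVal k (shift j x) ≠ wordVal k α ∧ wordVal k (shift j x) ≠ wordVal k (refl α)}
  have hZcl : IsClosed Z := by
    refine (isClosed_lexSet α).inter ?_
    simp only [Set.ofPred_forall]
    refine isClosed_iInter fun j => ?_
    have hc : Continuous fun x : Digits M => wordVal k (shift j x) :=
      (continuous_wordVal k).comp (continuous_shift j)
    exact (isClosed_discrete {n : ℕ | n ≠ wordVal k α ∧ n ≠ wordVal k (refl α)}).preimage hc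
  have hZs : ∀ i, ∀ x ∈ Z, shift i x ∈ Z := fun i x hx =>
    ⟨shift_mem_lexSet i hx.1, fun j => by rw [shift_shift]; exact hx.2 _⟩
  have hZr : ∀ x ∈ Z, refl x ∈ Z := fun x hx => ⟨refl_mem_lexSet hx.1, fun j => by
    have h1 := hx.2 j
    have h2 := wordVal_refl k (shift j x)
    have h3 := wordVal_refl k α
    rw [← refl_shift]
    omega⟩
  have hsub : lexSet α ⊆ Z ∪ ⋃ j : ℕ, shift j ⁻¹' {α, refl α} := by
    intro x hx
    by_cases hxZ : x ∈ Z
    · exact Or.inl hxZ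
    · have tail : ∀ y ∈ lexSet α, ∀ j, wordVal k (shift j y) = wordVal k α →
          shift (k + j) y = refl α := by
        intro y hy j hj
        refine WordLe.antisymm (fun n => ?_) (hy _).2
        have h1 := (hy j).1 (k + n)
        rw [wordVal_add, wordVal_add, hj, hk, shift_shift] at h1
        omega
      have hex : ∃ j, wordVal k (shift j x) = wordVal k α ∨
          wordVal k (shift j x) = wordVal k (refl α) := by
        by_contra hcon
        push Not at hcon
        exact hxZ ⟨hx, hcon⟩
      obtain ⟨j, hj | hj⟩ := hex
      · exact Or.inr (Set.mem_iUnion.mpr ⟨k + j, Or.inr (tail x hx j hj)⟩)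
      · refine Or.inr (Set.mem_iUnion.mpr ⟨k + j, Or.inl ?_⟩)
        have h1 := tail (refl x) (refl_mem_lexSet hx) j (by
          have h2 := wordVal_refl k (shift j x)
          have h3 := wordVal_refl k α
          rw [← refl_shift]
          omega)
        rw [← refl_shift] at h1
        have h2 := congrArg refl h1
        rwa [refl_refl, refl_refl] at h2
  have hdim : gdimH (rho M) (lexSet α) ≤ gdimH (rho M) Z := by
    refine (gdimH_mono hsub).trans (gdimH_union_le le_rfl (gdimH_iUnion_le fun j =>
      (gdimH_shift_preimage_le j _).trans ?_))
    rw [gdimH_countable ((Set.finite_singleton _).insert _).countable]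
    exact zero_le
  have hZne : Z.Nonempty := by
    by_contra hemp
    rw [Set.not_nonempty_iff_eq_empty] at hemp
    rw [hemp, gdimH_countable Set.countable_empty] at hdim
    exact absurd (hl.trans_le hdim) not_lt_zero
  obtain ⟨β, hβ, hmax⟩ := exists_lexmax hZcl hZne
  refine ⟨β, hβ.1, ?_, hl.trans_le (hdim.trans (gdimH_mono (subset_lexSet hZs hZr hmax)))⟩
  rintro rfl
  exact (hβ.2 0).1 rfl

/-! ### Generating functions -/

/-- The generating function governing the growth of the number of words of `lexSet β`. -/
noncomputable def genFun (β : Digits M) (z : ℂ) : ℂ :=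
  1 - ∑' j : ℕ, (2 * (β j : ℂ) - M) * z ^ (j + 1)

lemma norm_coeff_le (β : Digits M) (j : ℕ) : ‖(2 * (β j : ℂ) - M)‖ ≤ M := by
  have h := digit_le β j
  have : (2 * (β j : ℂ) - M) = ((2 * (β j : ℝ) - M : ℝ) : ℂ) := by push_cast; rfl
  rw [this, Complex.norm_real, Real.norm_eq_abs, abs_le]
  have : (0 : ℝ) ≤ (β j : ℝ) := by positivity
  constructor <;> linarith

lemma summable_bound {r : ℝ} (h0 : 0 ≤ r) (h1 : r < 1) (c : ℝ) :
    Summable fun j : ℕ => c * r ^ (j + 1) :=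
  ((summable_nat_add_iff 1).mpr (summable_geometric_of_lt_one h0 h1)).mul_left c

lemma norm_term_le (β : Digits M) (z : ℂ) (j : ℕ) :
    ‖(2 * (β j : ℂ) - M) * z ^ (j + 1)‖ ≤ M * ‖z‖ ^ (j + 1) := by
  rw [norm_mul, norm_pow]
  exact mul_le_mul_of_nonneg_right (norm_coeff_le β j) (by positivity)

lemma analyticOnNhd_genFun (β : Digits M) : AnalyticOnNhd ℂ (genFun β) (Metric.ball 0 1) := by
  have hr : ∀ r : ℝ, 0 < r → r < 1 → DifferentiableOn ℂ (genFun β) (Metric.ball 0 r) := by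
    intro r h0 h1
    refine (differentiableOn_const _).sub ?_
    refine Complex.differentiableOn_tsum_of_summable_norm (u := fun j => M * r ^ (j + 1))
      (summable_bound h0.le h1 _) (fun j => by fun_prop) Metric.isOpen_ball fun j w hw => ?_
    refine (norm_term_le β w j).trans ?_
    rw [mem_ball_zero_iff] at hw
    gcongr
  refine DifferentiableOn.analyticOnNhd (fun z hz => ?_) Metric.isOpen_ball
  rw [mem_ball_zero_iff] at hz
  obtain ⟨r, hr1, hr2⟩ := exists_between hz
  exact ((hr r ((norm_nonneg z).trans_lt hr1) hr2).differentiableAt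
    (Metric.isOpen_ball.mem_nhds (by rwa [mem_ball_zero_iff]))).differentiableWithinAt

lemma exists_genFun_ne_zero (β : Digits M) {a b : ℝ} (hab : a < b) (ha : 0 ≤ a) (hb : b ≤ 1) :
    ∃ z : ℝ, a < z ∧ z < b ∧ genFun β z ≠ 0 := by
  by_contra hcon
  push Not at hcon
  obtain ⟨c, hac, hcb⟩ := exists_between hab
  have hmem : ∀ x : ℝ, a < x → x < b → (x : ℂ) ∈ Metric.ball (0 : ℂ) 1 := fun x h1 h2 => by
    rw [mem_ball_zero_iff, Complex.norm_real, Real.norm_of_nonneg (by linarith)]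
    linarith
  have hfreq : ∃ᶠ z in nhdsWithin (c : ℂ) {(c : ℂ)}ᶜ, genFun β z = 0 := by
    have hev : ∀ᶠ x : ℝ in nhdsWithin (c : ℝ) ({c}ᶜ : Set ℝ), genFun β (x : ℂ) = 0 := by
      filter_upwards [nhdsWithin_le_nhds (Ioo_mem_nhds hac hcb)] with x hx
      exact hcon x hx.1 hx.2
    have ht : Filter.Tendsto (fun x : ℝ => (x : ℂ)) (nhdsWithin (c : ℝ) ({c}ᶜ : Set ℝ))
        (nhdsWithin (c : ℂ) {(c : ℂ)}ᶜ) := by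
      refine tendsto_nhdsWithin_iff.mpr ⟨?_, ?_⟩
      · exact (Complex.continuous_ofReal.tendsto c).mono_left nhdsWithin_le_nhds
      · filter_upwards [self_mem_nhdsWithin] with x hx
        simpa using hx
    exact ht.frequently hev.frequently
  have h0 := (analyticOnNhd_genFun β).eqOn_zero_of_preconnected_of_frequently_eq_zero
    (convex_ball 0 1).isPreconnected (hmem c hac hcb) hfreq (Metric.mem_ball_self one_pos)
  simp [genFun] at h0

lemma genFun_mul_tsum {β : Digits M} (hβ : β ∈ lexSet β) {z : ℝ} (hz0 : 0 ≤ z) (hz1 : z < 1)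
    (hs : Summable fun n => (numWords (lexSet β) n : ℝ) * z ^ n) :
    genFun β z * ((∑' n, (numWords (lexSet β) n : ℝ) * z ^ n : ℝ) : ℂ) = (1 - z : ℂ)⁻¹ := by
  set N := numWords (lexSet β) with hN
  have hzn : ‖(z : ℂ)‖ = z := by rw [Complex.norm_real, Real.norm_of_nonneg hz0]
  let u : ℕ → ℂ := fun j => (2 * (β j : ℂ) - M) * (z : ℂ) ^ (j + 1)
  let v : ℕ → ℂ := fun n => (N n : ℂ) * (z : ℂ) ^ n
  have hu : Summable fun j => ‖u j‖ :=
    (summable_bound hz0 hz1 M).of_nonneg_of_le (fun _ => norm_nonneg _) fun j => by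
      exact (norm_term_le β (z : ℂ) j).trans_eq (by rw [hzn])
  have hv : Summable fun j => ‖v j‖ := by
    refine hs.congr fun n => ?_
    simp only [v, norm_mul, norm_pow, hzn, Complex.norm_natCast]
  have hprod := tsum_mul_tsum_eq_tsum_sum_range_of_summable_norm hu hv
  have hrec : ∀ n, v (n + 1) = (z : ℂ) ^ (n + 1) + ∑ k ∈ Finset.range (n + 1), u k * v (n - k) := by
    intro n
    have h1 := congrArg (Int.cast (R := ℂ)) (numWords_eq_sum hβ (n + 1))
    push_cast at h1
    simp only [v, u]
    rw [hN, h1, add_mul, one_mul, Finset.sum_mul]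
    congr 1
    refine Finset.sum_congr rfl fun k hk => ?_
    have hk := Finset.mem_range.mp hk
    have : (z : ℂ) ^ (n + 1) = (z : ℂ) ^ (k + 1) * (z : ℂ) ^ (n - k) := by
      rw [← pow_add]; congr 1; omega
    rw [this]
    ring
  have hv0 : v 0 = 1 := by
    have h1 := congrArg (Int.cast (R := ℂ)) (numWords_eq_sum hβ 0)
    simpa [v] using h1
  have hsc : Summable fun n => ∑ k ∈ Finset.range (n + 1), u k * v (n - k) :=
    (summable_norm_sum_mul_range_of_summable_norm hu hv).of_norm
  have hgeo : Summable fun n : ℕ => (z : ℂ) ^ n :=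
    summable_geometric_of_norm_lt_one (by rwa [hzn])
  have htot : ∑' n, v n = (1 - z : ℂ)⁻¹ + (∑' j, u j) * ∑' n, v n := by
    conv_lhs => rw [hv.of_norm.tsum_eq_zero_add]
    simp_rw [hrec]
    rw [((summable_nat_add_iff 1).mpr hgeo).tsum_add hsc, hprod, ← add_assoc, hv0]
    congr 1
    rw [← tsum_geometric_of_norm_lt_one (by rwa [hzn]), hgeo.tsum_eq_zero_add, pow_zero]
  have hcast : ((∑' n, (N n : ℝ) * z ^ n : ℝ) : ℂ) = ∑' n, v n := by
    rw [Complex.ofReal_tsum]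
    refine tsum_congr fun n => ?_
    simp [v]
  rw [hcast]
  unfold genFun
  rw [sub_mul, one_mul]
  linear_combination htot

lemma tendsto_genFun_lowerPeriodic (α : Digits M) {z : ℝ} (hz0 : 0 ≤ z) (hz1 : z < 1) :
    Filter.Tendsto (fun m => genFun (lowerPeriodic α m) z) Filter.atTop (nhds (genFun α z)) := by
  have hzn : ‖(z : ℂ)‖ = z := by rw [Complex.norm_real, Real.norm_of_nonneg hz0]
  refine tendsto_const_nhds.sub (tendsto_tsum_of_dominated_convergence
    (bound := fun j => M * z ^ (j + 1)) (summable_bound hz0 hz1 _) (fun j => ?_)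
    (Filter.Eventually.of_forall fun m j =>
      (norm_term_le (lowerPeriodic α m) (z : ℂ) j).trans_eq (by rw [hzn])))
  refine tendsto_const_nhds.congr' ?_
  filter_upwards [Filter.eventually_gt_atTop (j + 1)] with m hm
  rw [lowerPeriodic_of_lt α (by omega)]

lemma summable_numWords (hM : 0 < M) {β : Digits M} {s t : ℝ≥0}
    (ht : gdimH (rho M) (lexSet β) < t) (hts : t < s) :
    Summable fun n => (numWords (lexSet β) n : ℝ) * (((M : ℝ) + 1) ^ (-(s : ℝ))) ^ n := by
  have hb : (1 : ℝ) < (M : ℝ) + 1 := by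
    have : (0 : ℝ) < M := by exact_mod_cast hM
    linarith
  obtain ⟨T, ℓ, w, hℓ, hsum, hcov⟩ := exists_finite_cover hM (isClosed_lexSet β) ht
  obtain ⟨C, hC⟩ := numWords_mul_pow_le (fun k _ hx => shift_mem_lexSet k hx)
    (z := ((M : ℝ) + 1) ^ (-(t : ℝ))) (by positivity)
    (Real.rpow_le_one_of_one_le_of_nonpos hb.le (by simp)) T ℓ w (fun i _ => hℓ i) hsum hcov
  set zt := ((M : ℝ) + 1) ^ (-(t : ℝ)) with hzt
  set zs := ((M : ℝ) + 1) ^ (-(s : ℝ)) with hzs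
  have hzt0 : 0 < zt := by positivity
  have hlt : zs < zt := Real.rpow_lt_rpow_of_exponent_lt hb (by
    have : (t : ℝ) < s := by exact_mod_cast hts
    linarith)
  have hgeo := (summable_geometric_of_lt_one (r := zs / zt) (by positivity)
    ((div_lt_one hzt0).mpr hlt)).mul_left C
  refine hgeo.of_nonneg_of_le (fun n => by positivity) fun n => ?_
  calc (numWords (lexSet β) n : ℝ) * zs ^ n = numWords (lexSet β) n * zt ^ n * (zs / zt) ^ n := by
        rw [div_pow]; field_simp
    _ ≤ C * (zs / zt) ^ n := by gcongr; exact hC n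

lemma gdimH_le_of_genFun_ne_zero (hM : 0 < M) (hα : α ∈ lexSet α) (h0 : refl α 0 < α 0)
    (hgap : ∀ k, 1 ≤ k → shift k α ≠ refl α) {l s : ℝ≥0} (hls : l < s)
    (hdim : ∀ m, 2 ≤ m → GoodPrefix α m → gdimH (rho M) (lexSet (lowerPeriodic α m)) ≤ l)
    (hne : genFun α ((((M : ℝ) + 1) ^ (-(s : ℝ)) : ℝ) : ℂ) ≠ 0) :
    gdimH (rho M) (lexSet α) ≤ s := by
  have hb : (1 : ℝ) < (M : ℝ) + 1 := by
    have : (0 : ℝ) < M := by exact_mod_cast hM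
    linarith
  set z := ((M : ℝ) + 1) ^ (-(s : ℝ)) with hz
  have hz0 : 0 ≤ z := by positivity
  have hs0 : (0 : ℝ) < s := by
    have : 0 < s := pos_of_gt hls
    exact_mod_cast this
  have hz1 : z < 1 := Real.rpow_lt_one_of_one_lt_of_neg hb (by linarith)
  set c := ‖genFun α (z : ℂ)‖ with hc
  have hc0 : 0 < c := norm_pos_iff.mpr hne
  have hev : ∀ᶠ m in Filter.atTop, c / 2 < ‖genFun (lowerPeriodic α m) z‖ :=
    (tendsto_genFun_lowerPeriodic α hz0 hz1).norm.eventually (lt_mem_nhds (by linarith))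
  obtain ⟨m₁, hm₁⟩ := Filter.eventually_atTop.mp hev
  refine gdimH_le_of_numWords_le (C := (1 - z)⁻¹ / (c / 2)) fun n => ?_
  obtain ⟨m, hm, hg⟩ := exists_goodPrefix hα hgap (m₁ + n + 2)
  set β := lowerPeriodic α m with hβ
  have hβm : β ∈ lexSet β := lowerPeriodic_mem_lexSet_self hα h0 hg (by omega)
  obtain ⟨t, hlt, hts⟩ := exists_between hls
  have hsum : Summable fun n => (numWords (lexSet β) n : ℝ) * z ^ n :=
    summable_numWords hM (lt_of_le_of_lt (hdim m (by omega) hg) (by exact_mod_cast hlt)) hts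
  have hmul := genFun_mul_tsum hβm hz0 hz1 hsum
  have hG0 : 0 ≤ ∑' n, (numWords (lexSet β) n : ℝ) * z ^ n := tsum_nonneg fun n => by positivity
  have hnorm := congrArg norm hmul
  rw [norm_mul, Complex.norm_real, Real.norm_of_nonneg hG0, norm_inv,
    show (1 - z : ℂ) = ((1 - z : ℝ) : ℂ) by push_cast; rfl, Complex.norm_real,
    Real.norm_of_nonneg (by linarith)] at hnorm
  have heq : numWords (lexSet α) n = numWords (lexSet β) n :=
    (numWords_eq_of_agree hβm hα (m := m - 1) (fun i hi => lowerPeriodic_of_lt α hi)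
      (by omega)).symm
  rw [heq]
  refine (hsum.le_tsum n fun _ _ => by positivity).trans ?_
  rw [le_div_iff₀ (by linarith), ← hnorm, mul_comm]
  have := hm₁ m (by omega)
  gcongr

/-- The dimension of `lexSet α` is approximated by smaller lexicographic subshifts. -/
lemma exists_lexSet_lt_gdimH (hM : 0 < M) (hα : α ∈ lexSet α) {l : ℝ≥0}
    (hl : (l : ℝ≥0∞) < gdimH (rho M) (lexSet α)) :
    ∃ β ∈ lexSet α, β ≠ α ∧ (l : ℝ≥0∞) < gdimH (rho M) (lexSet β) := by
  by_cases hgap : ∃ k, shift k α = refl α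
  · obtain ⟨k, hk⟩ := hgap
    exact exists_lexSet_of_shift_eq_refl hα hk hl
  push Not at hgap
  have h0 : refl α 0 < α 0 := by
    refine lt_of_le_of_ne (hα 0).2.head_le fun heq => ?_
    have hsub : (lexSet α).Subsingleton := by
      have hconst : ∀ x ∈ lexSet α, ∀ k, x k = α 0 := fun x hx k => by
        have h1 := (hx k).1.head_le
        have h2 := (hx k).2.head_le
        rw [heq] at h2
        have := le_antisymm h1 h2
        simpa [shift] using this
      exact fun x hx y hy => funext fun k => by rw [hconst x hx, hconst y hy]
    rw [gdimH_countable hsub.countable] at hl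
    exact not_lt_zero hl
  by_contra hcon
  push Not at hcon
  have hdim : ∀ m, 2 ≤ m → GoodPrefix α m →
      gdimH (rho M) (lexSet (lowerPeriodic α m)) ≤ l := fun m hm hg => by
    refine hcon _ (lowerPeriodic_mem_lexSet hα h0 hg hm) fun heq => ?_
    have := wordVal_lowerPeriodic_lt hα hg hm
    rw [heq] at this
    exact lt_irrefl _ this
  obtain ⟨t, hlt, ht⟩ := ENNReal.lt_iff_exists_nnreal_btwn.mp hl
  have hlt' : l < t := by exact_mod_cast hlt
  have hlt'' : (l : ℝ) < t := by exact_mod_cast hlt'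
  have hb : (1 : ℝ) < (M : ℝ) + 1 := by
    have : (0 : ℝ) < M := by exact_mod_cast hM
    linarith
  obtain ⟨z, hz1, hz2, hne⟩ := exists_genFun_ne_zero α
    (Real.rpow_lt_rpow_of_exponent_lt hb (neg_lt_neg hlt'')) (by positivity)
    (Real.rpow_le_one_of_one_le_of_nonpos hb.le (by simp))
  have hz0 : 0 < z := lt_of_le_of_lt (by positivity) hz1
  obtain ⟨s, hs⟩ : ∃ s : ℝ, s = -Real.logb ((M : ℝ) + 1) z := ⟨_, rfl⟩
  have hzs : z = ((M : ℝ) + 1) ^ (-s) := by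
    rw [hs, neg_neg, Real.rpow_logb (by linarith) (by linarith) hz0]
  rw [hzs] at hz1 hz2
  have h1 := (Real.rpow_lt_rpow_left_iff hb).mp hz1
  have h2 := (Real.rpow_lt_rpow_left_iff hb).mp hz2
  have hs0 : 0 ≤ s := by
    have : (0 : ℝ) ≤ l := l.coe_nonneg
    linarith
  lift s to ℝ≥0 using hs0
  have hls : l < s := by
    rw [← NNReal.coe_lt_coe]; linarith
  have hst : s < t := by
    rw [← NNReal.coe_lt_coe]; linarith
  rw [hzs] at hne
  have hle := gdimH_le_of_genFun_ne_zero hM hα h0 (fun k _ => hgap k) hls hdim hne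
  have : (s : ℝ≥0∞) < t := by exact_mod_cast hst
  exact absurd (ht.trans_le hle) (not_lt.mpr this.le)

end

/-! ### Continuity of the dimension of the tail sets -/

lemma gdimH_tailSet_mono {M : ℕ} {q r : ℝ} (hq : 1 < q) (hqr : q ≤ r) :
    gdimH (rho M) (tailSet M q) ≤ gdimH (rho M) (tailSet M r) :=
  gdimH_mono (tailSet_mono hq hqr)

lemma exists_lt_gdimH_tailSet {M : ℕ} (hM : 0 < M) {q : ℝ} (hq : 1 < q) {a : ℝ≥0∞}
    (ha : a < gdimH (rho M) (tailSet M q)) :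
    ∃ p, 1 < p ∧ p < q ∧ a < gdimH (rho M) (tailSet M p) := by
  obtain ⟨l, hal, hl⟩ := ENNReal.lt_iff_exists_nnreal_btwn.mp ha
  have hne : (tailSet M q).Nonempty := by
    by_contra hemp
    rw [Set.not_nonempty_iff_eq_empty] at hemp
    rw [hemp, gdimH_countable Set.countable_empty] at hl
    exact not_lt_zero hl
  obtain ⟨α, hα, heq, hα1⟩ := exists_tailSet_eq_lexSet hq hne
  rw [heq] at hl
  obtain ⟨β, hβ, hβne, hlβ⟩ := exists_lexSet_lt_gdimH hM hα hl
  obtain ⟨p, hp, hpq, hsub⟩ := exists_base_lt_of_mem_lexSet hM hq hα hα1 hβ hβne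
  exact ⟨p, hp, hpq, hal.trans (hlβ.trans_le (gdimH_mono hsub))⟩

lemma mem_tailSet_of_forall_gt {M : ℕ} {q : ℝ} (hq : 1 < q) {x : Digits M}
    (hx : ∀ n : ℕ, x ∈ tailSet M (q + 1 / ((n : ℝ) + 1))) : x ∈ tailSet M q := by
  have hlim : ∀ y : Digits M, Filter.Tendsto (fun n : ℕ => piQ M (q + 1 / ((n : ℝ) + 1)) y)
      Filter.atTop (nhds (piQ M q y)) := fun y => by
    have h1 : ContinuousAt (fun q => piQ M q y) q :=
      (continuousOn_piQ_base y).continuousAt (Ioi_mem_nhds hq)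
    refine h1.tendsto.comp ?_
    simpa using tendsto_const_nhds.add (tendsto_one_div_add_atTop_nhds_zero_nat (𝕜 := ℝ))
  exact fun k => ⟨le_of_tendsto' (hlim _) fun n => (hx n k).1,
    le_of_tendsto' (hlim _) fun n => (hx n k).2⟩

lemma exists_gdimH_tailSet_le {M : ℕ} (hM : 0 < M) {q : ℝ} (hq : 1 < q) {s : ℝ≥0}
    (hs : gdimH (rho M) (tailSet M q) < s) :
    ∃ r, q < r ∧ gdimH (rho M) (tailSet M r) ≤ s := by
  obtain ⟨t, ℓ, w, hℓ, hsum, hcov⟩ := exists_finite_cover hM (isClosed_tailSet hq) hs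
  set O : Set (Digits M) := ⋃ i ∈ t, {x | wordVal (ℓ i) x = w i} with hO
  have hOo : IsOpen O := isOpen_biUnion fun i _ => isOpen_cylinder _ _
  have hpos : ∀ n : ℕ, 0 < 1 / ((n : ℝ) + 1) := fun n => by positivity
  by_cases hex : ∃ n : ℕ, tailSet M (q + 1 / ((n : ℝ) + 1)) ⊆ O
  · obtain ⟨n, hn⟩ := hex
    refine ⟨_, lt_add_of_pos_right q (hpos n), gdimH_le_of_cover
      (fun k _ hx => shift_mem_tailSet k hx) t ℓ w (fun i _ => hℓ i) hsum fun x hx => ?_⟩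
    simpa [hO] using hn hx
  · exfalso
    push Not at hex
    have hcl : ∀ n : ℕ, IsClosed (tailSet M (q + 1 / ((n : ℝ) + 1)) ∩ Oᶜ) := fun n =>
      (isClosed_tailSet (by linarith [hpos n])).inter hOo.isClosed_compl
    obtain ⟨x, hx⟩ := IsCompact.nonempty_iInter_of_sequence_nonempty_isCompact_isClosed
      (fun n : ℕ => tailSet M (q + 1 / ((n : ℝ) + 1)) ∩ Oᶜ)
      (fun n => Set.inter_subset_inter_left _ (tailSet_mono (by linarith [hpos (n + 1)]) (by
        have : 1 / (((n + 1 : ℕ) : ℝ) + 1) ≤ 1 / ((n : ℝ) + 1) :=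
          one_div_le_one_div_of_le (by positivity) (by push_cast; linarith)
        linarith)))
      (fun n => by
        obtain ⟨x, hx, hxO⟩ := Set.not_subset.mp (hex n)
        exact ⟨x, hx, hxO⟩)
      (hcl 0).isCompact hcl
    rw [Set.mem_iInter] at hx
    obtain ⟨i, hi, hix⟩ := hcov x (mem_tailSet_of_forall_gt hq fun n => (hx n).1)
    exact (hx 0).2 (Set.mem_biUnion hi hix)

lemma continuousOn_gdimH_tailSet {M : ℕ} (hM : 0 < M) :
    ContinuousOn (fun q => gdimH (rho M) (tailSet M q)) (Set.Ioi 1) := by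
  intro q hq
  refine ContinuousAt.continuousWithinAt (tendsto_order.mpr ⟨fun a ha => ?_, fun a ha => ?_⟩)
  · obtain ⟨p, hp, hpq, hap⟩ := exists_lt_gdimH_tailSet hM hq ha
    filter_upwards [Ioi_mem_nhds hpq] with r hr
    exact hap.trans_le (gdimH_tailSet_mono hp (le_of_lt hr))
  · obtain ⟨s, hs, hsa⟩ := ENNReal.lt_iff_exists_nnreal_btwn.mp ha
    obtain ⟨r, hqr, hr⟩ := exists_gdimH_tailSet_le hM hq hs
    filter_upwards [Ioo_mem_nhds hq hqr] with p hp
    exact ((gdimH_tailSet_mono hp.1 hp.2.le).trans hr).trans_lt hsa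

/-! ### Lower bounds for the dimension of `UxSym` -/

lemma gdimH_tailSet_le_of_forall_exists {M : ℕ} {q x : ℝ}
    (h : ∀ d ∈ tailSet M q, ∃ k, ∃ c ∈ UxSym M x, shift k c = d) :
    gdimH (rho M) (tailSet M q) ≤ gdimH (rho M) (UxSym M x) := by
  have hsub : tailSet M q ⊆ ⋃ k : ℕ, shift k '' UxSym M x := fun d hd => by
    obtain ⟨k, c, hc, rfl⟩ := h d hd
    exact Set.mem_iUnion.mpr ⟨k, c, hc, rfl⟩
  exact (gdimH_mono hsub).trans (gdimH_iUnion_le fun k => gdimH_shift_image_le k _)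

lemma piQ_lt_one_of_mem_tailSet {M : ℕ} {q p : ℝ} (hq : 1 < q) (hqp : q < p) {d : Digits M}
    (hd : d ∈ tailSet M q) : piQ M p d < 1 := by
  have h1 := piQ_scale hq hqp.le d
  have h2 := (hd 0).1
  rw [shift_zero] at h2
  have h3 : q / p < 1 := (div_lt_one (by linarith)).mpr hqp
  have h4 : 0 < q / p := div_pos (by linarith) (by linarith)
  nlinarith

lemma exists_base_piQ_eq {M : ℕ} {p r x : ℝ} (hp : 1 < p) (hpr : p ≤ r) {c : Digits M}
    (h1 : x ≤ piQ M p c) (h2 : piQ M r c ≤ x) : ∃ t, p ≤ t ∧ t ≤ r ∧ piQ M t c = x := by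
  have hcont : ContinuousOn (fun q => piQ M q c) (Set.Icc p r) :=
    (continuousOn_piQ_base c).mono fun q hq => hp.trans_le hq.1
  obtain ⟨t, ht, htx⟩ := intermediate_value_Icc' hpr hcont ⟨h2, h1⟩
  exact ⟨t, ht.1, ht.2, htx⟩

lemma mem_UqSym_of_shift_mem_tailSet {M : ℕ} {q p : ℝ} (hq : 1 < q) (hqp : q < p) {c : Digits M}
    {L : ℕ} (hd : shift L c ∈ tailSet M q)
    (hup : ∀ i, i + 1 < L → (c i : ℕ) < M → piQ M p (shift (i + 1) c) < 1)
    (hlow : ∀ i, i + 1 < L → 0 < (c i : ℕ) → piQ M p (refl (shift (i + 1) c)) < 1) :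
    c ∈ UqSym M p := by
  have hmem : ∀ i, ¬ i + 1 < L → shift (i + 1) c ∈ tailSet M q := fun i hi => by
    have := shift_mem_tailSet (i + 1 - L) hd
    rwa [shift_shift, Nat.sub_add_cancel (by omega)] at this
  refine mem_UqSym (hq.trans hqp) (fun i hi => ?_) fun i hi => ?_
  · by_cases h : i + 1 < L
    · exact hup i h hi
    · exact piQ_lt_one_of_mem_tailSet hq hqp (hmem i h)
  · by_cases h : i + 1 < L
    · exact hlow i h hi
    · exact piQ_lt_one_of_mem_tailSet hq hqp (refl_mem_tailSet (hmem i h))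

/-- The largest digit sequence. -/
def full (M : ℕ) : Digits M := fun _ => Fin.last M

lemma preVal_refl_full {M : ℕ} (q : ℝ) (n : ℕ) : preVal q n (refl (full M)) = 0 :=
  Finset.sum_eq_zero fun i _ => by simp [refl, full]

lemma piQ_splice_full {M : ℕ} {q : ℝ} (hq : 1 < q) (n : ℕ) (d : Digits M) :
    piQ M q (splice n (full M) d) = M / (q - 1) - piQ M q (refl d) / q ^ n := by
  have h1 := piQ_refl hq (splice n (full M) d)
  rw [refl_splice, piQ_splice hq, preVal_refl_full] at h1
  linarith

lemma gdimH_tailSet_le_of_one_le {M : ℕ} (hM : 0 < M) {x q : ℝ} (hx : 1 ≤ x) (hq : 1 < q)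
    (hqx : q < qx M x) : gdimH (rho M) (tailSet M q) ≤ gdimH (rho M) (UxSym M x) := by
  have hx0 : 0 < x := by linarith
  have hM' : (0 : ℝ) < M := by exact_mod_cast hM
  obtain ⟨q₁, hq1, hq1x⟩ := exists_between hqx
  have hqx1 : qx M x ≤ 1 + M / x := min_le_right _ _
  have hval : x < M / (q₁ - 1) := by
    rw [lt_div_iff₀ (by linarith)]
    have h : q₁ - 1 < M / x := by linarith
    rw [lt_div_iff₀ hx0] at h
    linarith
  have hqxval : M / (qx M x - 1) ≤ x := by
    have h : qx M x = 1 + M / x := by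
      refine min_eq_right ?_
      have : (M : ℝ) / x ≤ M := div_le_self hM'.le hx
      linarith
    rw [h, add_sub_cancel_left, div_div_cancel₀ hM'.ne']
  refine gdimH_tailSet_le_of_forall_exists fun d hd => ?_
  have hlim : Filter.Tendsto (fun n : ℕ => M / (q₁ - 1) - piQ M q₁ (refl d) / q₁ ^ n) Filter.atTop
      (nhds (M / (q₁ - 1) - 0)) := by
    refine tendsto_const_nhds.sub (Filter.Tendsto.const_div_atTop ?_ _)
    exact tendsto_pow_atTop_atTop_of_one_lt (by linarith)
  rw [sub_zero] at hlim
  obtain ⟨N, hN⟩ := (hlim.eventually (lt_mem_nhds hval)).exists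
  rw [← piQ_splice_full (by linarith)] at hN
  obtain ⟨p, hp1, hp2, hpx⟩ := exists_base_piQ_eq (by linarith) hq1x.le hN.le
    ((piQ_le (by linarith) _).trans hqxval)
  refine ⟨N, splice N (full M) d, (mem_UxSym_iff hx0).mpr ⟨p, by linarith,
    hp2.trans (qx_bounds hM hx0).2, ?_, hpx⟩, shift_splice _ _ _⟩
  refine mem_UqSym_of_shift_mem_tailSet hq (by linarith) (L := N) (by rwa [shift_splice]) ?_ ?_
  · intro i hi hlt
    rw [splice, if_pos (by omega)] at hlt
    simp [full] at hlt
  · intro i hi _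
    rw [shift_splice_of_le hi.le, refl_splice, piQ_splice (by linarith)]
    have h0 : preVal p (N - (i + 1)) (refl (shift (i + 1) (full M))) = 0 := preVal_refl_full p _
    rw [h0, zero_add]
    exact (div_le_self (piQ_nonneg (by linarith) _) (one_le_pow₀ (by linarith))).trans_lt
      (piQ_lt_one_of_mem_tailSet hq (by linarith) (refl_mem_tailSet hd))

lemma mem_UxSym_of_close {M : ℕ} (hM : 0 < M) {x q : ℝ} (hx : 0 < x) (hq : 1 < q) {c : Digits M}
    {L : ℕ} (hd : shift L c ∈ tailSet M q) (h1 : piQ M (M + 1) c < x)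
    (h2 : x - 2 / ((M : ℝ) + 1) ^ L ≤ piQ M (M + 1) c)
    {δ : ℝ} (hδdef : δ = 2 * ((M : ℝ) + 1) / (x * ((M : ℝ) + 1) ^ L))
    (hδq : q < M + 1 - δ) (hδM : δ < M / 2)
    (hup : ∀ p, q < p → p < M + 1 → piQ M p c = x → ∀ i, i + 1 < L → (c i : ℕ) < M →
      piQ M p (shift (i + 1) c) < 1)
    (hlow : ∀ i, i + 1 < L → 0 < (c i : ℕ) → 2 * δ < piQ M (M + 1) (shift (i + 1) c)) :
    c ∈ UxSym M x := by
  have hM1 : (1 : ℝ) ≤ M := by exact_mod_cast hM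
  have hb : (1 : ℝ) < (M : ℝ) + 1 := by linarith
  have hδ0 : 0 < δ := by rw [hδdef]; positivity
  have hbL : (0 : ℝ) < ((M : ℝ) + 1) ^ L := by positivity
  have hδx : δ * x = 2 * ((M : ℝ) + 1) / ((M : ℝ) + 1) ^ L := by rw [hδdef]; field_simp
  have hscale := piQ_scale (q := (M : ℝ) + 1 - δ) (r := (M : ℝ) + 1) (by linarith) (by linarith) c
  have hq1 : x ≤ piQ M (M + 1 - δ) c := by
    have h3 : (M + 1 - δ) * x ≤ (M + 1 - δ) * piQ M (M + 1 - δ) c := by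
      rw [div_mul_eq_mul_div, le_div_iff₀ (by linarith)] at hscale
      have h4 : (x - 2 / ((M : ℝ) + 1) ^ L) * (M + 1) ≤ piQ M (M + 1) c * (M + 1) := by gcongr
      have h5 : 2 / ((M : ℝ) + 1) ^ L * (M + 1) = δ * x := by rw [hδx]; ring
      linarith
    exact le_of_mul_le_mul_left h3 (by linarith)
  obtain ⟨p, hp1, hp2, hpx⟩ := exists_base_piQ_eq (by linarith) (by linarith) hq1 h1.le
  have hpb : p < M + 1 := lt_of_le_of_ne hp2 fun h => by rw [h] at hpx; linarith
  refine (mem_UxSym_iff hx).mpr ⟨p, by linarith, hp2, mem_UqSym_of_shift_mem_tailSet hq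
    (by linarith) hd (hup p (by linarith) hpb hpx) fun i hi hpos => ?_, hpx⟩
  rw [piQ_refl (by linarith)]
  have h3 := hlow i hi hpos
  have h4 := piQ_anti (by linarith) hp2 (shift (i + 1) c)
  have h5 : M / (p - 1) ≤ 1 + 2 * δ := by
    rw [div_le_iff₀ (by linarith)]
    nlinarith
  linarith

lemma exists_greedy {M : ℕ} (hM : 0 < M) {x : ℝ} (hx0 : 0 < x) (hx1 : x < 1) :
    ∃ g : Digits M, piQ M (M + 1) g = x ∧ ∀ i, piQ M (M + 1) (shift i g) < 1 := by
  have hM1 : (1 : ℝ) ≤ M := by exact_mod_cast hM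
  have hb : (1 : ℝ) < (M : ℝ) + 1 := by linarith
  have hmax : (M : ℝ) / ((M : ℝ) + 1 - 1) = 1 := by
    rw [add_sub_cancel_right]; exact div_self (by linarith)
  obtain ⟨d, hd⟩ := exists_expansion (M := M) hb le_rfl hx0.le (by rw [hmax]; exact hx1.le)
  obtain ⟨g, hg, hgmax⟩ := exists_lexmax (X := {d : Digits M | piQ M (M + 1) d = x})
    (isClosed_eq (continuous_piQ hb) continuous_const) ⟨d, hd⟩
  have hg' : piQ M (M + 1) g = x := hg
  refine ⟨g, hg', fun i => ?_⟩
  induction i with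
  | zero => rwa [shift_zero, hg']
  | succ n ih =>
    by_contra hcon
    have h1 : piQ M (M + 1) (shift (n + 1) g) = 1 :=
      le_antisymm ((piQ_le hb _).trans_eq hmax) (not_lt.mp hcon)
    have h2 := piQ_head_shift hb n g
    have h3 : (g n : ℝ) < M := by nlinarith
    have h4 : (g n : ℕ) < M := by exact_mod_cast h3
    let v : Digits M := fun i => if i = n then ⟨g n + 1, by omega⟩ else g i
    have hpre : preVal ((M : ℝ) + 1) (n + 1) v =
        preVal ((M : ℝ) + 1) (n + 1) g + 1 / ((M : ℝ) + 1) ^ (n + 1) := by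
      rw [preVal_succ, preVal_succ, preVal_congr (y := g) fun i hi => by simp [v, hi.ne]]
      simp only [v, if_true]
      push_cast
      ring
    let z : Digits M := splice (n + 1) v (refl (full M))
    have hz : piQ M (M + 1) z = x := by
      have h0 : piQ M (M + 1) (refl (full M)) = 0 := by simp [piQ, refl, full]
      rw [piQ_splice hb, hpre, h0, ← hg', piQ_eq_preVal_add hb (n + 1) g, h1]
      ring
    have h5 := hgmax z hz (n + 1)
    have h6 : wordVal (n + 1) g < wordVal (n + 1) z := by
      refine wordVal_lt_of_lt (n := n) (fun i hi => ?_) ?_ (Nat.lt_add_one n)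
      · simp [z, splice, v, hi.ne, Nat.lt_succ_of_lt hi]
      · simp only [z, splice, v, Nat.lt_add_one, if_true, Fin.lt_def]
    omega

lemma piQ_shift_le_of_agree {M : ℕ} {p r : ℝ} (hp : 1 < p) (hpr : p ≤ r) {c g : Digits M}
    (h : piQ M p c ≤ piQ M r g) {n : ℕ} (hn : ∀ i < n, c i = g i) {i : ℕ} (hi : i ≤ n) :
    piQ M p (shift i c) ≤ piQ M r (shift i g) := by
  induction i with
  | zero => simpa using h
  | succ i ih =>
    have h1 := piQ_head_shift hp i c
    have h2 := piQ_head_shift (hp.trans_le hpr) i g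
    rw [hn i (by omega)] at h1
    have h3 := ih (by omega)
    have h4 := piQ_nonneg hp (shift i c)
    nlinarith

lemma one_div_pow_le_piQ {M : ℕ} {q : ℝ} (hq : 1 < q) {x : Digits M} {j : ℕ}
    (hj : 0 < (x j : ℕ)) : 1 / q ^ (j + 1) ≤ piQ M q x := by
  refine le_trans ?_ (preVal_le_piQ hq (j + 1) x)
  have h1 : (1 : ℝ) ≤ x j := by exact_mod_cast hj
  have h2 := preVal_nonneg (by linarith : 0 < q) j x
  have h3 : 1 / q ^ (j + 1) ≤ (x j : ℝ) / q ^ (j + 1) := by gcongr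
  rw [preVal_succ]
  linarith

lemma one_sub_le_piQ {M : ℕ} (hM : 0 < M) {q : ℝ} (hq : 1 < q) (hqb : q < M + 1) {d : Digits M}
    (hd : d ∈ tailSet M q) : 1 - q / (M + 1) ≤ piQ M (M + 1) d := by
  have hM1 : (1 : ℝ) ≤ M := by exact_mod_cast hM
  have h1 := piQ_scale hq hqb.le (refl d)
  have h2 := (hd 0).2
  rw [shift_zero] at h2
  rw [piQ_refl (by linarith), add_sub_cancel_right, div_self (by linarith)] at h1
  have : q / ((M : ℝ) + 1) * piQ M q (refl d) ≤ q / ((M : ℝ) + 1) * 1 := by gcongr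
  linarith

/-- The prefix of `g` of length `n` with its last digit lowered by one. -/
def lowerAt {M : ℕ} (g : Digits M) (n : ℕ) : Digits M := fun i =>
  if i + 1 = n then ⟨g i - 1, by have := (g i).isLt; omega⟩ else g i

lemma lowerAt_of_lt {M : ℕ} (g : Digits M) {n i : ℕ} (hi : i + 1 < n) : lowerAt g n i = g i :=
  if_neg (by omega)

lemma preVal_lowerAt {M : ℕ} (q : ℝ) {g : Digits M} {n : ℕ} (hn : 0 < (g n : ℕ)) :
    preVal q (n + 1) (lowerAt g (n + 1)) = preVal q (n + 1) g - 1 / q ^ (n + 1) := by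
  rw [preVal_succ, preVal_succ, preVal_congr (y := g) fun i hi => lowerAt_of_lt g (by omega)]
  simp only [lowerAt, if_true, Nat.cast_sub (Nat.succ_le_of_lt hn)]
  push_cast
  ring

lemma tendsto_close (M : ℕ) (hM : 0 < M) (x : ℝ) :
    Filter.Tendsto (fun L : ℕ => 2 * ((M : ℝ) + 1) / (x * ((M : ℝ) + 1) ^ L)) Filter.atTop
      (nhds 0) := by
  have hM1 : (1 : ℝ) ≤ M := by exact_mod_cast hM
  have h := Filter.Tendsto.const_div_atTop
    (tendsto_pow_atTop_atTop_of_one_lt (by linarith : (1 : ℝ) < (M : ℝ) + 1))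
    (2 * ((M : ℝ) + 1) / x)
  refine h.congr fun L => ?_
  rw [div_div]

lemma exists_of_greedy_finite {M : ℕ} (hM : 0 < M) {x q : ℝ} (hx : 0 < x) (hq : 1 < q)
    (hqb : q < M + 1) {g : Digits M} (hg : piQ M (M + 1) g = x)
    (hg1 : ∀ i, piQ M (M + 1) (shift i g) < 1) (hfin : EndsInZero g) {d : Digits M}
    (hd : d ∈ tailSet M q) : ∃ k, ∃ c ∈ UxSym M x, shift k c = d := by
  have hM1 : (1 : ℝ) ≤ M := by exact_mod_cast hM
  have hb : (1 : ℝ) < (M : ℝ) + 1 := by linarith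
  have hzero : ∀ y : Digits M, (∀ i, y i = 0) → piQ M (M + 1) y = 0 := fun y hy => by
    simp [piQ, hy]
  have hfind : Nat.find hfin ≠ 0 := fun hf => by
    have := Nat.find_spec hfin
    rw [hf] at this
    rw [hzero g fun i => this i (by omega)] at hg
    linarith
  obtain ⟨n, hn⟩ := Nat.exists_eq_succ_of_ne_zero hfind
  have hspec := Nat.find_spec hfin
  have hmin := Nat.find_min hfin (m := n) (by omega)
  rw [hn] at hspec
  have hgn : g n ≠ 0 := fun h => hmin fun m hm => by
    rcases hm.eq_or_lt with rfl | hm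
    · exact h
    · exact hspec m hm
  have hgn' : 0 < (g n : ℕ) := Fin.pos_iff_ne_zero.mpr hgn
  have htail : piQ M (M + 1) (shift (n + 1) g) = 0 := hzero _ fun i => hspec _ (by omega)
  have hgpre : preVal ((M : ℝ) + 1) (n + 1) g = x := by
    rw [piQ_eq_preVal_add hb (n + 1), htail] at hg
    simpa using hg
  have hlim := (tendsto_close M hM x).comp (Filter.tendsto_add_atTop_nat (n + 1))
  have hη : 0 < min (min ((M : ℝ) + 1 - q) (M / 2)) (1 / ((M : ℝ) + 1) ^ (n + 2) / 2) :=
    lt_min (lt_min (by linarith) (by linarith)) (by positivity)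
  obtain ⟨N, hNsmall, hN⟩ := ((hlim.eventually (gt_mem_nhds hη)).and
    (Filter.eventually_ge_atTop 1)).exists
  simp only [Function.comp_apply] at hNsmall
  rw [lt_min_iff, lt_min_iff] at hNsmall
  set c := splice (n + 1) (lowerAt g (n + 1)) (splice N (full M) d) with hc
  have hshift : shift (N + (n + 1)) c = d := by
    rw [← shift_shift, hc, shift_splice, shift_splice]
  have hval : piQ M (M + 1) c = x - piQ M (M + 1) (refl d) / ((M : ℝ) + 1) ^ (N + (n + 1)) := by
    rw [hc, piQ_splice hb, preVal_lowerAt _ hgn', hgpre, piQ_splice_full hb,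
      add_sub_cancel_right, div_self (by linarith), pow_add]
    field_simp
    ring
  have hb0 : 0 < ((M : ℝ) + 1) ^ (N + (n + 1)) := by positivity
  have hr0 : 0 < piQ M (M + 1) (refl d) := by
    have := one_sub_le_piQ hM hq hqb (refl_mem_tailSet hd)
    have h2 : q / ((M : ℝ) + 1) < 1 := (div_lt_one (by linarith)).mpr hqb
    linarith
  have hr1 := piQ_lt_one_of_mem_tailSet hq hqb (refl_mem_tailSet hd)
  have hcM : ∀ i, n < i → i < N + (n + 1) → c i = Fin.last M := fun i h1 h2 => by
    rw [hc, splice, if_neg (by omega), splice, if_pos (by omega), full]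
  refine ⟨N + (n + 1), c, mem_UxSym_of_close hM hx hq (L := N + (n + 1)) (by rwa [hshift]) ?_ ?_
    rfl (by linarith [hNsmall.1.1]) hNsmall.1.2 ?_ ?_, hshift⟩
  · rw [hval]
    have : 0 < piQ M (M + 1) (refl d) / ((M : ℝ) + 1) ^ (N + (n + 1)) := by positivity
    linarith
  · rw [hval]
    gcongr
    linarith
  · intro p hqp hpb hpx i hi hciM
    have hagree : ∀ j < n, c j = g j := fun j hj => by
      rw [hc, splice, if_pos (by omega), lowerAt_of_lt g (by omega)]
    have hle : ∀ j ≤ n, piQ M p (shift j c) ≤ piQ M (M + 1) (shift j g) := fun j hj =>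
      piQ_shift_le_of_agree (by linarith) hpb.le (by rw [hpx, hg]) hagree hj
    rcases lt_trichotomy i n with h | rfl | h
    · exact (hle _ h).trans_lt (hg1 _)
    · have e1 := piQ_head_shift (by linarith) i c (q := p)
      have e2 := piQ_head_shift hb i g
      have e3 := hle i le_rfl
      have e4 : (c i : ℝ) = g i - 1 := by
        have : (c i : ℕ) = g i - 1 := by
          rw [hc, splice, if_pos (by omega), lowerAt, if_pos rfl]
        rw [this, Nat.cast_sub (by omega), Nat.cast_one]
      rw [htail] at e2
      have e5 : (1 : ℝ) ≤ g i := by exact_mod_cast hgn'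
      have e6 : 0 < piQ M (M + 1) (shift i g) := by
        by_contra hcon
        nlinarith
      have e7 : p * piQ M p (shift i c) < (M + 1) * piQ M (M + 1) (shift i g) := by
        calc p * piQ M p (shift i c) ≤ p * piQ M (M + 1) (shift i g) :=
            mul_le_mul_of_nonneg_left e3 (by linarith)
          _ < _ := by gcongr
      linarith
    · rw [hcM i h (by omega)] at hciM
      simp at hciM
  · intro i hi _
    have hpos : ∃ j ≤ n + 1, 0 < (shift (i + 1) c j : ℕ) := by
      rcases le_or_gt i n with h | h
      · refine ⟨n - i, by omega, ?_⟩
        rw [shift, hcM _ (by omega) (by omega), Fin.val_last]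
        exact hM
      · refine ⟨0, by omega, ?_⟩
        rw [shift, hcM _ (by omega) (by omega), Fin.val_last]
        exact hM
    obtain ⟨j, hj, hj'⟩ := hpos
    have h1 := one_div_pow_le_piQ hb hj'
    have h2 : 1 / ((M : ℝ) + 1) ^ (n + 2) ≤ 1 / ((M : ℝ) + 1) ^ (j + 1) :=
      one_div_le_one_div_of_le (by positivity) (pow_le_pow_right₀ hb.le (by omega))
    linarith [hNsmall.2]

lemma exists_of_greedy_infinite {M : ℕ} (hM : 0 < M) {x q : ℝ} (hx : 0 < x) (hq : 1 < q)
    (hqb : q < M + 1) {g : Digits M} (hg : piQ M (M + 1) g = x)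
    (hg1 : ∀ i, piQ M (M + 1) (shift i g) < 1) (hinf : ¬ EndsInZero g) {d : Digits M}
    (hd : d ∈ tailSet M q) : ∃ k, ∃ c ∈ UxSym M x, shift k c = d := by
  have hM1 : (1 : ℝ) ≤ M := by exact_mod_cast hM
  have hb : (1 : ℝ) < (M : ℝ) + 1 := by linarith
  have hdig : ∀ N, ∃ n ≥ N, 0 < (g n : ℕ) := fun N => by
    by_contra hcon
    push Not at hcon
    exact hinf ⟨N, fun n hn => Fin.ext (Nat.le_zero.mp (hcon n hn))⟩
  set θ := 1 - q / ((M : ℝ) + 1) with hθdef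
  have hθ : 0 < θ := by
    have h2 : q / ((M : ℝ) + 1) < 1 := (div_lt_one (by linarith)).mpr hqb
    linarith
  obtain ⟨K, hK⟩ := pow_unbounded_of_one_lt (4 * ((M : ℝ) + 1) / (x * θ)) hb
  obtain ⟨m, hm, hgm⟩ := hdig K
  have hη : 0 < min (min ((M : ℝ) + 1 - q) (M / 2)) (1 / ((M : ℝ) + 1) ^ (m + 1) / 2) :=
    lt_min (lt_min (by linarith) (by linarith)) (by positivity)
  obtain ⟨N, hN⟩ := Filter.eventually_atTop.mp
    ((tendsto_close M hM x).eventually (gt_mem_nhds hη))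
  obtain ⟨n, hn, hgn⟩ := hdig (N + m + 1)
  have hNsmall := hN (n + 1) (by omega)
  rw [lt_min_iff, lt_min_iff] at hNsmall
  set c := splice (n + 1) (lowerAt g (n + 1)) d with hc
  have hshift : shift (n + 1) c = d := by rw [hc, shift_splice]
  have hval : piQ M (M + 1) c = preVal ((M : ℝ) + 1) (n + 1) g
      + (piQ M (M + 1) d - 1) / ((M : ℝ) + 1) ^ (n + 1) := by
    rw [hc, piQ_splice hb, preVal_lowerAt _ hgn]
    ring
  have hxval := piQ_eq_preVal_add hb (n + 1) g
  rw [hg] at hxval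
  have hb0 : 0 < ((M : ℝ) + 1) ^ (n + 1) := by positivity
  have hd1 := piQ_lt_one_of_mem_tailSet hq hqb hd
  have hd0 := one_sub_le_piQ hM hq hqb hd
  have hr0 := piQ_nonneg hb (shift (n + 1) g)
  have hr1 := hg1 (n + 1)
  have hagree : ∀ j < n, c j = g j := fun j hj => by
    rw [hc, splice, if_pos (by omega), lowerAt_of_lt g (by omega)]
  refine ⟨n + 1, c, mem_UxSym_of_close hM hx hq (L := n + 1) (by rwa [hshift]) ?_ ?_
    rfl (by linarith [hNsmall.1.1]) hNsmall.1.2 ?_ ?_, hshift⟩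
  · rw [hval, hxval]
    exact (add_lt_add_iff_left _).mpr (div_lt_div_of_pos_right (by linarith) hb0)
  · rw [hval, hxval, add_sub_assoc, ← sub_div]
    exact (add_le_add_iff_left _).mpr (div_le_div_of_nonneg_right (by linarith) hb0.le)
  · intro p hqp hpb hpx i hi _
    exact (piQ_shift_le_of_agree (by linarith) hpb.le (by rw [hpx, hg]) hagree
      (by omega)).trans_lt (hg1 _)
  · intro i hi _
    rcases le_or_gt (i + 1) K with h | h
    · have hpos : 0 < (shift (i + 1) c (m - (i + 1)) : ℕ) := by
        rw [shift, Nat.sub_add_cancel (by omega), hagree m (by omega)]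
        exact hgm
      have h1 := one_div_pow_le_piQ hb hpos
      have h2 : 1 / ((M : ℝ) + 1) ^ (m + 1) ≤ 1 / ((M : ℝ) + 1) ^ (m - (i + 1) + 1) :=
        one_div_le_one_div_of_le (by positivity) (pow_le_pow_right₀ hb.le (by omega))
      linarith [hNsmall.2]
    · rw [hc, shift_splice_of_le hi.le, piQ_splice hb]
      have h1 := preVal_nonneg (by linarith : (0 : ℝ) < M + 1) (n + 1 - (i + 1))
        (shift (i + 1) (lowerAt g (n + 1)))
      have h2 : ((M : ℝ) + 1) ^ K ≤ ((M : ℝ) + 1) ^ (i + 1) := pow_le_pow_right₀ hb.le h.le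
      have h3 : ((M : ℝ) + 1) ^ (n + 1) =
          ((M : ℝ) + 1) ^ (n + 1 - (i + 1)) * ((M : ℝ) + 1) ^ (i + 1) := by
        rw [← pow_add]; congr 1; omega
      have h4 : 4 * ((M : ℝ) + 1) / (x * θ) < ((M : ℝ) + 1) ^ (i + 1) := hK.trans_le h2
      have h5 : 0 < ((M : ℝ) + 1) ^ (n + 1 - (i + 1)) := by positivity
      have h6 : 0 < ((M : ℝ) + 1) ^ (i + 1) := by positivity
      have h7 : 2 * (2 * ((M : ℝ) + 1) / (x * ((M : ℝ) + 1) ^ (n + 1))) <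
          θ / ((M : ℝ) + 1) ^ (n + 1 - (i + 1)) := by
        rw [div_lt_iff₀ (by positivity)] at h4
        rw [h3, ← mul_div_assoc, div_lt_div_iff₀ (by positivity) h5]
        nlinarith
      have h8 : θ / ((M : ℝ) + 1) ^ (n + 1 - (i + 1)) ≤
          piQ M (M + 1) d / ((M : ℝ) + 1) ^ (n + 1 - (i + 1)) := by gcongr
      linarith

lemma gdimH_tailSet_le_UxSym {M : ℕ} (hM : 0 < M) {x q : ℝ} (hx : 0 < x) (hq : 1 < q)
    (hqx : q < qx M x) : gdimH (rho M) (tailSet M q) ≤ gdimH (rho M) (UxSym M x) := by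
  rcases le_or_gt 1 x with h1 | h1
  · exact gdimH_tailSet_le_of_one_le hM h1 hq hqx
  · have hqb : q < M + 1 := hqx.trans_le (qx_bounds hM hx).2
    obtain ⟨g, hg, hg1⟩ := exists_greedy hM hx h1
    refine gdimH_tailSet_le_of_forall_exists fun d hd => ?_
    by_cases hfin : EndsInZero g
    · exact exists_of_greedy_finite hM hx hq hqb hg hg1 hfin hd
    · exact exists_of_greedy_infinite hM hx hq hqb hg hg1 hfin hd

/-- The dimension of `UxSym M x` depends on `x` through `qx M x` only. -/
lemma gdimH_UxSym_eq {M : ℕ} (hM : 0 < M) {x : ℝ} (hx : 0 < x) :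
    gdimH (rho M) (UxSym M x) = gdimH (rho M) (tailSet M (qx M x)) := by
  refine le_antisymm (gdimH_UxSym_le hx) (le_of_not_gt fun hlt => ?_)
  obtain ⟨p, hp, hpq, hlt'⟩ := exists_lt_gdimH_tailSet hM (qx_bounds hM hx).1 hlt
  exact absurd (gdimH_tailSet_le_UxSym hM hx hp hpq) (not_le.mpr hlt')

/-! ### The bases at which the tail sets may change -/

/-- The bases `q` for which some sequence in `tailSet M q` has value one. -/
def critBases (M : ℕ) : Set ℝ := {q | 1 < q ∧ ∃ y ∈ tailSet M q, piQ M q y = 1}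

lemma tailSet_eq_of_disjoint {M : ℕ} {q r : ℝ} (hq : 1 < q) (hqr : q ≤ r)
    (h : ∀ p, q ≤ p → p ≤ r → p ∉ critBases M) : tailSet M q = tailSet M r := by
  refine (tailSet_mono hq hqr).antisymm ?_
  rcases (tailSet M r).eq_empty_or_nonempty with hemp | hne
  · rw [hemp]; exact Set.empty_subset _
  obtain ⟨α, hα, heq, hα1⟩ := exists_tailSet_eq_lexSet (hq.trans_le hqr) hne
  rw [heq]
  rcases le_or_gt (piQ M q α) 1 with h1 | h1
  · exact lexSet_subset_tailSet hq h1
  · obtain ⟨p, hqp, hpr, hp⟩ := exists_base_piQ_eq hq hqr h1.le hα1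
    exact absurd ⟨hq.trans_le hqp, α, lexSet_subset_tailSet (hq.trans_le hqp) hp.le hα, hp⟩
      (h p hqp hpr)

lemma isCompact_critBases_inter {M : ℕ} {a b : ℝ} (ha : 1 < a) :
    IsCompact (critBases M ∩ Set.Icc a b) := by
  set S : Set (ℝ × Digits M) := Set.Icc a b ×ˢ Set.univ with hS
  have hScl : IsClosed S := isClosed_Icc.prod isClosed_univ
  have hScomp : IsCompact S := isCompact_Icc.prod isCompact_univ
  have hcont : ∀ f : Digits M → Digits M, Continuous f →
      ContinuousOn (fun z : ℝ × Digits M => piQ M z.1 (f z.2)) S := fun f hf =>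
    (continuousOn_piQ M).comp (by fun_prop : Continuous fun z : ℝ × Digits M =>
      (z.1, f z.2)).continuousOn fun z hz => ⟨ha.trans_le hz.1.1, Set.mem_univ _⟩
  have hK : IsCompact ((S ∩ (fun z : ℝ × Digits M => piQ M z.1 z.2) ⁻¹' {1}) ∩
      ⋂ k, ((S ∩ (fun z : ℝ × Digits M => piQ M z.1 (shift k z.2)) ⁻¹' Set.Iic 1) ∩
        (S ∩ (fun z : ℝ × Digits M => piQ M z.1 (refl (shift k z.2))) ⁻¹' Set.Iic 1))) := by
    refine hScomp.of_isClosed_subset (IsClosed.inter ?_ (isClosed_iInter fun k =>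
      IsClosed.inter ?_ ?_)) fun z hz => hz.1.1
    · exact (hcont id continuous_id).preimage_isClosed_of_isClosed hScl isClosed_singleton
    · exact (hcont _ (continuous_shift k)).preimage_isClosed_of_isClosed hScl isClosed_Iic
    · exact (hcont _ (continuous_refl.comp (continuous_shift k))).preimage_isClosed_of_isClosed
        hScl isClosed_Iic
  convert hK.image continuous_fst using 1
  ext q
  constructor
  · rintro ⟨⟨hq, y, hy, hy1⟩, hqab⟩
    have hmem : (q, y) ∈ S := ⟨hqab, Set.mem_univ _⟩
    exact ⟨(q, y), ⟨⟨hmem, hy1⟩, Set.mem_iInter.mpr fun k =>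
      ⟨⟨hmem, (hy k).1⟩, ⟨hmem, (hy k).2⟩⟩⟩, rfl⟩
  · rintro ⟨⟨q, y⟩, ⟨⟨hmem, hy1⟩, hy⟩, rfl⟩
    rw [Set.mem_iInter] at hy
    exact ⟨⟨ha.trans_le hmem.1.1, y, fun k => ⟨(hy k).1.2, (hy k).2.2⟩, hy1⟩, hmem.1⟩

lemma eventually_tailSet_eq {M : ℕ} {q : ℝ} (hq : 1 < q) (hqc : q ∉ critBases M) :
    ∀ᶠ r in nhds q, tailSet M r = tailSet M q := by
  obtain ⟨a, ha1, haq⟩ := exists_between hq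
  have hcl := (isCompact_critBases_inter (M := M) (b := q + 1) ha1).isClosed
  have hnhds : Set.Ioo a (q + 1) ∩ (critBases M ∩ Set.Icc a (q + 1))ᶜ ∈ nhds q :=
    Filter.inter_mem (Ioo_mem_nhds haq (by linarith)) (hcl.isOpen_compl.mem_nhds fun h => hqc h.1)
  obtain ⟨η, hη, hball⟩ := Metric.mem_nhds_iff.mp hnhds
  have hno : ∀ p, |p - q| < η → 1 < p ∧ p ∉ critBases M := fun p hp => by
    have h := hball (Metric.mem_ball.mpr hp)
    exact ⟨ha1.trans h.1.1, fun hpc => h.2 ⟨hpc, h.1.1.le, h.1.2.le⟩⟩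
  filter_upwards [Metric.ball_mem_nhds q hη] with r hr
  have hr' : |r - q| < η := hr
  have hr'' := abs_lt.mp hr'
  rcases le_total r q with h | h
  · exact tailSet_eq_of_disjoint (hno r hr').1 h fun p h1 h2 => (hno p (by
      rw [abs_lt]; constructor <;> linarith)).2
  · exact (tailSet_eq_of_disjoint hq h fun p h1 h2 => (hno p (by
      rw [abs_lt]; constructor <;> linarith)).2).symm

lemma preVal_head {M : ℕ} {q : ℝ} (n : ℕ) (x : Digits M) :
    preVal q (n + 1) x = (x 0 + preVal q n (shift 1 x)) / q := by
  rw [preVal, Finset.sum_range_succ', preVal, add_div, Finset.sum_div, add_comm]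
  congr 1
  · simp
  · refine Finset.sum_congr rfl fun i _ => ?_
    rw [shift, div_div, ← pow_succ]

lemma preVal_sub_le {M : ℕ} {s p : ℝ} (hs : 1 < s) (hsp : s ≤ p) (n : ℕ) (x : Digits M) :
    preVal s n x - preVal p n x ≤ M / (s - 1) ^ 2 * (p - s) := by
  have hs1 : 0 < s - 1 := by linarith
  have hC : 0 ≤ M / (s - 1) ^ 2 * (p - s) := mul_nonneg (by positivity) (by linarith)
  induction n generalizing x with
  | zero => simpa [preVal] using hC
  | succ n ih =>
    have h1 := preVal_head (q := s) n x
    have h2 := preVal_head (q := p) n x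
    have h3 := ih (shift 1 x)
    have h4 := (preVal_le_piQ hs (n + 1) x).trans (piQ_le hs x)
    rw [eq_div_iff (by linarith)] at h1 h2
    set A := preVal s (n + 1) x
    set B := preVal p (n + 1) x
    have h5 : (A - B) * p ≤ M / (s - 1) ^ 2 * (p - s) + M / (s - 1) * (p - s) := by
      have : A * (p - s) ≤ M / (s - 1) * (p - s) := mul_le_mul_of_nonneg_right h4 (by linarith)
      nlinarith
    have h6 : M / (s - 1) * (p - s) = M / (s - 1) ^ 2 * (p - s) * (s - 1) := by
      field_simp
    rw [h6] at h5
    have h7 : (A - B) * p ≤ M / (s - 1) ^ 2 * (p - s) * p := by nlinarith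
    exact le_of_mul_le_mul_right h7 (by linarith)

lemma preVal_scale {M : ℕ} {s p : ℝ} (hs : 0 < s) (hsp : s ≤ p) (n : ℕ) (x : Digits M) :
    p * preVal p n x ≤ s * preVal s n x := by
  rw [preVal, preVal, Finset.mul_sum, Finset.mul_sum]
  refine Finset.sum_le_sum fun i _ => ?_
  have hp : 0 < p := by linarith
  have h1 : ∀ t : ℝ, 0 < t → t * ((x i : ℝ) / t ^ (i + 1)) = (x i : ℝ) / t ^ i := fun t ht => by
    rw [pow_succ]; field_simp
  rw [h1 p hp, h1 s hs]
  gcongr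

lemma not_mem_critBases {M : ℕ} {q p : ℝ} {y : Digits M} (hqy : y ∈ tailSet M q)
    (hy : piQ M q y = 1) (hp : 1 < p) (hpq : p < q) {n : ℕ} (h1 : preVal p n y < 1)
    (h2 : (1 - preVal p n y) * p ^ n < M / (q - 1) - 1) : p ∉ critBases M := by
  rintro ⟨-, z, hz, hz1⟩
  have hagree : ∀ i < n, z i = y i := by
    by_contra hcon
    push Not at hcon
    obtain ⟨i, hin, hne⟩ := hcon
    obtain ⟨j, hj, hjne⟩ := exists_agree_of_ne (c := z) (d := y) fun h => hne (by rw [h])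
    have hjn : j < n := by
      by_contra hnj
      exact hne (hj i (by omega))
    rcases lt_or_gt_of_ne hjne with hlt | hlt
    · have h3 := piQ_le_of_first_lt hp hj hlt
      have h4 := (hz (j + 1)).1
      have h5 : preVal p (j + 1) y ≤ preVal p n y :=
        Finset.sum_le_sum_of_subset_of_nonneg (Finset.range_subset_range.mpr hjn)
          fun _ _ _ => by positivity
      have h6 : (piQ M p (shift (j + 1) z) - 1) / p ^ (j + 1) ≤ 0 :=
        div_nonpos_of_nonpos_of_nonneg (by linarith) (by positivity)
      linarith
    · have h3 := piQ_le_of_first_lt (hp.trans hpq) (fun i hi => (hj i hi).symm) hlt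
      have h4 := (hqy (j + 1)).1
      have h5 := preVal_le_piQ (hp.trans hpq) (j + 1) z
      have h6 : (piQ M q (shift (j + 1) y) - 1) / q ^ (j + 1) ≤ 0 :=
        div_nonpos_of_nonpos_of_nonneg (by linarith) (pow_nonneg (by linarith) _)
      have h7 := piQ_lt_one_of_mem_tailSet hp hpq hz
      linarith
  have h3 := piQ_eq_preVal_add hp n z
  rw [preVal_congr hagree, hz1] at h3
  have h4 := (hz n).2
  rw [piQ_refl hp] at h4
  have h5 : M / (q - 1) ≤ M / (p - 1) :=
    div_le_div_of_nonneg_left (by positivity) (by linarith) (by linarith)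
  have h6 : (1 - preVal p n y) * p ^ n = piQ M p (shift n z) := by
    have : p ^ n ≠ 0 := by positivity
    field_simp at h3
    linarith
  linarith

lemma exists_gap {M : ℕ} (hM : 0 < M) {q : ℝ} (hqM : q < M + 1) (hq : q ∈ critBases M) :
    ∃ κ > 0, ∀ᶠ n : ℕ in Filter.atTop, ∃ s, q - q / q ^ n ≤ s ∧ s + κ * (q / q ^ n) ≤ q ∧
      ∀ p ∈ Set.Ioo s (s + κ * (q / q ^ n)), p ∉ critBases M := by
  obtain ⟨hq1, y, hqy, hy⟩ := hq
  have hM' : (0 : ℝ) < M := by exact_mod_cast hM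
  set ε := M / (q - 1) - 1 with hε
  have hε0 : 0 < ε := by
    have : 1 < M / (q - 1) := by rw [lt_div_iff₀ (by linarith)]; linarith
    linarith
  set Λ := M / ((q - 1) / 2) ^ 2 with hΛ
  have hq10 : 0 < q - 1 := by linarith
  have hΛ0 : 0 < Λ := by positivity
  refine ⟨ε / (q * Λ), by positivity, ?_⟩
  have hlim : Filter.Tendsto (fun n : ℕ => q / q ^ n) Filter.atTop (nhds 0) :=
    Filter.Tendsto.const_div_atTop (tendsto_pow_atTop_atTop_of_one_lt hq1) _
  filter_upwards [hlim.eventually (gt_mem_nhds (show 0 < (q - 1) / 2 by linarith))] with n hn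
  have hqn : 0 < q ^ n := by positivity
  have hκ : ε / (q * Λ) * (q / q ^ n) = ε / q ^ n / Λ := by field_simp
  set r := q / q ^ n with hr
  have hr0 : 0 < r := by positivity
  have htail : preVal q n y = 1 - piQ M q (shift n y) / q ^ n := by
    have := piQ_eq_preVal_add hq1 n y
    linarith
  have ht1 := (hqy n).1
  have ht2 := (hqy n).2
  rw [piQ_refl hq1] at ht2
  have hlow : 1 ≤ preVal (q - r) n y := by
    have h1 := preVal_scale (by linarith : 0 < q - r) (by linarith : q - r ≤ q) n y
    have h2 : q - r ≤ q * preVal q n y := by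
      rw [htail, mul_sub, mul_one, hr]
      have : q * (piQ M q (shift n y) / q ^ n) ≤ q * (1 / q ^ n) := by gcongr
      rw [mul_one_div] at this
      linarith
    have h3 : (q - r) * 1 ≤ (q - r) * preVal (q - r) n y := by linarith
    exact le_of_mul_le_mul_left h3 (by linarith)
  have hhigh : preVal q n y ≤ 1 - ε / q ^ n := by
    rw [htail]
    have : ε / q ^ n ≤ piQ M q (shift n y) / q ^ n := by gcongr; linarith
    linarith
  have hcont : ContinuousOn (fun p => preVal p n y) (Set.Icc (q - r) q) := by
    refine continuousOn_finsetSum _ fun i _ => ?_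
    refine continuousOn_const.div (by fun_prop) fun p hp => ?_
    have : 0 < p := by linarith [hp.1]
    positivity
  have hεn : 0 < ε / q ^ n := by positivity
  obtain ⟨s, hs, hs1⟩ := intermediate_value_Icc' (by linarith) hcont
    (show (1 : ℝ) ∈ Set.Icc _ _ from ⟨by linarith, hlow⟩)
  simp only at hs1
  have hlip : ∀ p, s ≤ p → 1 - preVal p n y ≤ Λ * (p - s) := fun p hsp => by
    have h1 := preVal_sub_le (by linarith [hs.1] : 1 < s) hsp n y
    rw [hs1] at h1
    refine h1.trans (mul_le_mul_of_nonneg_right ?_ (by linarith))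
    have : (q - 1) / 2 ≤ s - 1 := by linarith [hs.1]
    rw [hΛ]
    gcongr
  refine ⟨s, hs.1, ?_, fun p hp => ?_⟩
  · rw [hκ]
    have h1 := hlip q hs.2
    have h2 : ε / q ^ n / Λ ≤ q - s := by
      rw [div_le_iff₀ hΛ0]
      linarith
    linarith
  · rw [hκ] at hp
    have h1 := hlip q hs.2
    have h2 : ε / q ^ n / Λ ≤ q - s := by
      rw [div_le_iff₀ hΛ0]
      linarith
    have hpq : p < q := by linarith [hp.2]
    have hs0 : 1 < s := by linarith [hs.1]
    have hp1 : 1 < p := by linarith [hp.1]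
    have h3 := preVal_scale (by linarith : 0 < s) hp.1.le n y
    rw [hs1, mul_one] at h3
    refine not_mem_critBases hqy hy hp1 hpq (n := n) ?_ ?_
    · by_contra hcon
      nlinarith [hp.1]
    · have h4 := hlip p hp.1.le
      have h5 : p - s < ε / q ^ n / Λ := by linarith [hp.2]
      rw [lt_div_iff₀ hΛ0] at h5
      have h6 : 1 - preVal p n y < ε / q ^ n := by linarith
      rw [lt_div_iff₀ hqn] at h6
      have h7 : p ^ n ≤ q ^ n := by gcongr
      have h8 : 0 ≤ 1 - preVal p n y := by
        by_contra hcon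
        nlinarith [hp.1]
      exact (mul_le_mul_of_nonneg_left h7 h8).trans_lt h6

open MeasureTheory in
lemma volume_critBases_inter_Icc {M : ℕ} (hM : 0 < M) {a b : ℝ} (ha : 1 < a) (hb : b < M + 1) :
    volume (critBases M ∩ Set.Icc a b) = 0 := by
  set S := critBases M ∩ Set.Icc a b with hS
  have hmeas : MeasurableSet S := (isCompact_critBases_inter ha).isClosed.measurableSet
  have hae := Besicovitch.ae_tendsto_measure_inter_div volume S
  rw [ae_restrict_iff' hmeas] at hae
  refine measure_mono_null (fun q hq => ?_) hae
  intro hcon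
  have hlim := hcon hq
  have hq1 : 1 < q := hq.1.1
  obtain ⟨κ, hκ, hgap⟩ := exists_gap hM (hq.2.2.trans_lt hb) hq.1
  have hr0 : ∀ n : ℕ, 0 < q / q ^ n := fun n => by positivity
  have hrlim : Filter.Tendsto (fun n : ℕ => q / q ^ n) Filter.atTop (nhdsWithin 0 (Set.Ioi 0)) :=
    tendsto_nhdsWithin_iff.mpr
      ⟨Filter.Tendsto.const_div_atTop (tendsto_pow_atTop_atTop_of_one_lt hq1) _,
        Filter.Eventually.of_forall hr0⟩
  have hle : ∀ᶠ n : ℕ in Filter.atTop,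
      volume (S ∩ Metric.closedBall q (q / q ^ n)) / volume (Metric.closedBall q (q / q ^ n)) ≤
        ENNReal.ofReal (1 - κ / 2) := by
    filter_upwards [hgap] with n hn
    obtain ⟨s, hs1, hs2, hs3⟩ := hn
    set r := q / q ^ n with hr
    have hr0 : 0 < r := hr0 n
    have hκr : 0 < κ * r := by positivity
    have hsub : S ∩ Metric.closedBall q r ⊆
        Set.Icc (q - r) s ∪ Set.Icc (s + κ * r) (q + r) := by
      rintro p ⟨hpS, hp⟩
      rw [Real.closedBall_eq_Icc] at hp
      by_cases h1 : p ≤ s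
      · exact Or.inl ⟨hp.1, h1⟩
      · refine Or.inr ⟨?_, hp.2⟩
        by_contra h2
        exact hs3 p ⟨not_le.mp h1, not_le.mp h2⟩ hpS.1
    have hvol : volume (S ∩ Metric.closedBall q r) ≤ ENNReal.ofReal ((1 - κ / 2) * (2 * r)) := by
      refine (measure_mono hsub).trans ((measure_union_le _ _).trans ?_)
      rw [Real.volume_Icc, Real.volume_Icc, ← ENNReal.ofReal_add (by linarith) (by linarith)]
      exact ENNReal.ofReal_le_ofReal (by linarith)
    rw [Real.volume_closedBall]
    refine ENNReal.div_le_of_le_mul (hvol.trans_eq ?_)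
    rw [← ENNReal.ofReal_mul' (by linarith)]
  have h1 := le_of_tendsto (hlim.comp hrlim) hle
  rw [← ENNReal.ofReal_one, ENNReal.ofReal_le_ofReal_iff'] at h1
  rcases h1 with h1 | h1 <;> linarith

open MeasureTheory in
lemma volume_critBases_inter_Ioo {M : ℕ} (hM : 0 < M) :
    volume (critBases M ∩ Set.Ioo 1 ((M : ℝ) + 1)) = 0 := by
  have hsub : critBases M ∩ Set.Ioo 1 ((M : ℝ) + 1) ⊆ ⋃ n : ℕ, critBases M ∩
      Set.Icc (1 + 1 / ((n : ℝ) + 1)) (M + 1 - 1 / ((n : ℝ) + 1)) := by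
    rintro q ⟨hq, hq1, hqM⟩
    obtain ⟨n, hn⟩ := exists_nat_one_div_lt (show 0 < min (q - 1) (M + 1 - q) from
      lt_min (by linarith) (by linarith))
    rw [lt_min_iff] at hn
    exact Set.mem_iUnion.mpr ⟨n, hq, by linarith [hn.1], by linarith [hn.2]⟩
  refine measure_mono_null hsub (measure_iUnion_null fun n => ?_)
  have : 0 < 1 / ((n : ℝ) + 1) := by positivity
  exact volume_critBases_inter_Icc hM (by linarith) (by linarith)

open MeasureTheory in
lemma volume_qx_mem_critBases {M : ℕ} (hM : 0 < M) :
    volume {x : ℝ | 1 < x ∧ qx M x ∈ critBases M} = 0 := by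
  have hM' : (0 : ℝ) < M := by exact_mod_cast hM
  have hdiff : DifferentiableOn ℝ (fun q : ℝ => M / (q - 1))
      (critBases M ∩ Set.Ioo 1 ((M : ℝ) + 1)) := fun q hq => by
    have : q - 1 ≠ 0 := by linarith [hq.2.1]
    exact DifferentiableAt.differentiableWithinAt (by fun_prop (disch := assumption))
  refine measure_mono_null ?_ (addHaar_image_eq_zero_of_differentiableOn_of_addHaar_eq_zero
    volume hdiff (volume_critBases_inter_Ioo hM))
  rintro x ⟨hx, hxc⟩
  have hdiv : (M : ℝ) / x < M := div_lt_self hM' hx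
  have hpos : (0 : ℝ) < M / x := by positivity
  have hqx : qx M x = 1 + M / x := min_eq_right (by linarith)
  rw [hqx] at hxc
  refine ⟨1 + M / x, ⟨hxc, by linarith, by linarith⟩, ?_⟩
  simp only [add_sub_cancel_left]
  rw [div_div_cancel₀ hM'.ne']

lemma continuousOn_qx (M : ℕ) : ContinuousOn (qx M) (Set.Ioi 0) :=
  continuous_min.comp_continuousOn (continuousOn_const.prodMk (continuousOn_const.add
    (continuousOn_const.div continuousOn_id fun _ hx => (Set.mem_Ioi.mp hx).ne')))

lemma qx_anti (M : ℕ) {x y : ℝ} (hx : 0 < x) (hxy : x ≤ y) : qx M y ≤ qx M x := by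
  unfold qx
  gcongr

lemma qx_of_le_one {M : ℕ} {x : ℝ} (hx : 0 < x) (hx1 : x ≤ 1) : qx M x = M + 1 := by
  refine min_eq_left ?_
  have : (M : ℝ) ≤ M / x := by
    rw [le_div_iff₀ hx]
    exact mul_le_of_le_one_right (by positivity) hx1
  linarith

/-- The function `φ(x) = dim_H 𝐔(x)` maps `(0,∞)` into `[0,1]`, is non-increasing and
continuous on `(0,∞)`, and Lebesgue-almost every `x ∈ (0,∞)` has an open neighborhood
on which `φ` is constant. -/
theorem phi_devil_staircase (M : ℕ) (hM : 0 < M) :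
    (∀ x ∈ Set.Ioi (0 : ℝ), gdimH (rho M) (UxSym M x) ≤ 1) ∧
    AntitoneOn (fun x : ℝ => gdimH (rho M) (UxSym M x)) (Set.Ioi 0) ∧
    ContinuousOn (fun x : ℝ => gdimH (rho M) (UxSym M x)) (Set.Ioi 0) ∧
    ∀ᵐ x ∂(MeasureTheory.volume.restrict (Set.Ioi (0 : ℝ))),
      ∃ ε > 0, ∀ y ∈ Set.Ioo (x - ε) (x + ε),
        gdimH (rho M) (UxSym M y) = gdimH (rho M) (UxSym M x) := by
  refine ⟨fun x _ => ?_, fun x hx y _ hxy => ?_, ?_, ?_⟩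
  · refine gdimH_le_of_numWords_le (s := 1) (C := 1) fun n => ?_
    have h : (numWords (UxSym M x) n : ℝ) ≤ ((M : ℝ) + 1) ^ n := by
      exact_mod_cast numWords_le (UxSym M x) n
    rw [NNReal.coe_one, Real.rpow_neg_one, inv_pow, ← div_eq_mul_inv]
    exact div_le_one_of_le₀ h (by positivity)
  · simp only
    rw [gdimH_UxSym_eq hM hx, gdimH_UxSym_eq hM (lt_of_lt_of_le hx hxy)]
    exact gdimH_tailSet_mono (qx_bounds hM (lt_of_lt_of_le hx hxy)).1 (qx_anti M hx hxy)
  · refine ((continuousOn_gdimH_tailSet hM).comp (continuousOn_qx M)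
      fun x hx => (qx_bounds hM hx).1).congr fun x hx => gdimH_UxSym_eq hM hx
  · rw [MeasureTheory.ae_restrict_iff' measurableSet_Ioi]
    have h1 : ∀ᵐ x : ℝ, x ≠ 1 := by simp [MeasureTheory.ae_iff]
    have h2 : ∀ᵐ x : ℝ, ¬ (1 < x ∧ qx M x ∈ critBases M) := by
      simpa [MeasureTheory.ae_iff] using volume_qx_mem_critBases hM
    filter_upwards [h1, h2] with x hx1 hx2 hx
    have hx0 : 0 < x := hx
    have hev : ∀ᶠ y in nhds x, tailSet M (qx M y) = tailSet M (qx M x) := by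
      rcases lt_or_gt_of_ne hx1 with h | h
      · filter_upwards [Ioo_mem_nhds hx0 h] with y hy
        rw [qx_of_le_one hx0 h.le, qx_of_le_one hy.1 hy.2.le]
      · exact ((continuousOn_qx M).continuousAt (Ioi_mem_nhds hx0)).eventually
          (eventually_tailSet_eq (qx_bounds hM hx0).1 fun hc => hx2 ⟨h, hc⟩)
    obtain ⟨ε, hε, hball⟩ := Metric.eventually_nhds_iff_ball.mp (hev.and (Ioi_mem_nhds hx0))
    refine ⟨ε, hε, fun y hy => ?_⟩
    rw [← Real.ball_eq_Ioo] at hy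
    obtain ⟨h3, h4⟩ := hball y hy
    rw [gdimH_UxSym_eq hM h4, gdimH_UxSym_eq hM hx0, h3]

end Expansions
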